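/- arXiv:1906.01125 — 4 statements merged into one kernel-verified Lean document; each statement's English description precedes it below -/
import Mathlib

section
/- The subalgebra of S_n-invariant elements of R = ℂ[X_{n×m}; Θ_{n×m'}] is equal to the ℂ-subalgebra of R generated by the finite set {p_S : S a colored multiset with 1 ≤ |S| ≤ n}. -/
open scoped TensorProduct

/-- A colored multiset in the alphabet `{1,…,m} ∪ {1̄,…,m̄'}`: the function records the
multiplicity of each unbarred entry, the finset records the (unrepeated) barred entries. -/
abbrev CMS (m m' : ℕ) := (Fin m → ℕ) × Finset (Fin m')

/-- The size `|S|` of a colored multiset. -/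
def CMS.size {m m' : ℕ} (S : CMS m m') : ℕ := (∑ j, S.1 j) + S.2.card

/-- The ring `ℂ[X_{n×m}; Θ_{n×m'}]`. -/
abbrev R (n m m' : ℕ) := MvPolynomial (Fin n × Fin m) ℂ ⊗[ℂ] ExteriorAlgebra ℂ ((Fin n × Fin m') → ℂ)

/-- The anticommuting generator `θ_{ij'}`. -/
noncomputable def theta (n m m' : ℕ) (i : Fin n) (j' : Fin m') : R n m m' :=
  1 ⊗ₜ ExteriorAlgebra.ι ℂ (Pi.single (i, j') 1)

/-- The monomial `x_{r1}^{a_1}⋯x_{rm}^{a_m}·θ_{r s_1}⋯θ_{r s_k}` attached to a row `r` and a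
colored multiset `S` (the `θ`-factors taken in increasing order of the barred indices). -/
noncomputable def mon (n m m' : ℕ) (r : Fin n) (S : CMS m m') : R n m m' :=
  ((∏ j, MvPolynomial.X (r, j) ^ S.1 j : MvPolynomial (Fin n × Fin m) ℂ) ⊗ₜ[ℂ] 1) *
    ((S.2.sort (· ≤ ·)).map (fun j' => theta n m m' r j')).prod

/-- The power sum generator `p_S`. -/
noncomputable def pS (n : ℕ) {m m' : ℕ} (S : CMS m m') : R n m m' :=
  ∑ r : Fin n, mon n m m' r S

/-- The action of `σ ∈ S_n` on `R` by algebra automorphisms, `σ·x_{ij} = x_{σ(i)j}` and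
`σ·θ_{ij'} = θ_{σ(i)j'}`. -/
noncomputable def act {n m m' : ℕ} (σ : Equiv.Perm (Fin n)) : R n m m' →ₐ[ℂ] R n m m' :=
  Algebra.TensorProduct.map
    (MvPolynomial.rename (fun p => (σ p.1, p.2)))
    (ExteriorAlgebra.map (LinearMap.funLeft ℂ ℂ (fun p => (σ⁻¹ p.1, p.2))))

namespace PSum

section Gen
variable {n : ℕ} {A : Type*} [Ring A] [Algebra ℂ A]

noncomputable def MM : Finset (Fin n) → List (Fin n → A) → A
  | _, [] => 1
  | U, a :: L => ∑ r ∈ Uᶜ, a r * MM (insert r U) L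

def PL (P : ℕ → (Fin n → A) → Prop) : ℕ → List (Fin n → A) → Prop
  | D, [] => D = 0
  | D, a :: L => ∃ d e, D = d + e ∧ P d a ∧ PL P e L

def Cm (a b : Fin n → A) : Prop := ∃ c : ℂ, ∀ r s, a r * b s = c • (b s * a r)

structure Good (P : ℕ → (Fin n → A) → Prop) : Prop where
  mul : ∀ d e a b, P d a → P e b → P (d + e) (a * b)
  smul : ∀ d (c : ℂ) a, P d a → P d (c • a)
  comm : ∀ d e a b, P d a → P e b → Cm a b

lemma sum_MM (b : Fin n → A) (LL : List (List (Fin n → A))) (U : Finset (Fin n)) :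
    ∑ s ∈ Uᶜ, b s * (LL.map (MM (insert s U))).sum
      = (LL.map (fun L' => MM U (b :: L'))).sum := by
  induction LL with
  | nil => simp
  | cons L LL ih => simp [mul_add, Finset.sum_add_distrib, ih, MM]

lemma expand {P : ℕ → (Fin n → A) → Prop} (hP : Good P) (d : ℕ) (a : Fin n → A) (ha : P d a)
    (L : List (Fin n → A)) : ∀ (D : ℕ), PL P D L →
    ∃ LL : List (List (Fin n → A)), LL.length = L.length ∧
      (∀ L' ∈ LL, L'.length = L.length ∧ L'.prod = a * L.prod ∧ PL P (d + D) L') ∧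
      ∀ U, ∑ r ∈ Uᶜ, a r * MM U L = MM U (a :: L) + (LL.map (MM U)).sum := by
  induction L with
  | nil =>
    intro D _
    exact ⟨[], rfl, by simp, by simp [MM]⟩
  | cons b L ih =>
    rintro D ⟨d', e, rfl, hb, hL⟩
    obtain ⟨LL, hlen, hLL, hU⟩ := ih e hL
    obtain ⟨c, hc⟩ := hP.comm _ _ _ _ ha hb
    refine ⟨(a * b :: L) :: LL.map (fun L' => (c • b) :: L'), by simp [hlen], ?_, ?_⟩
    · intro L' hL'
      rw [List.mem_cons, List.mem_map] at hL'
      rcases hL' with rfl | ⟨L', h, rfl⟩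
      · exact ⟨by simp, by simp [mul_assoc], d + d', e, by ring, hP.mul _ _ _ _ ha hb, hL⟩
      · obtain ⟨h1, h2, h3⟩ := hLL _ h
        refine ⟨by simp [h1], ?_, d', d + e, by ring, hP.smul _ _ _ hb, h3⟩
        rw [List.prod_cons, List.prod_cons, h2, ← mul_assoc, ← mul_assoc]
        congr 1
        funext r
        simp [hc r r]
    · intro U
      rw [List.map_cons, List.sum_cons, List.map_map]
      have e1 : ∑ r ∈ Uᶜ, a r * MM U (b :: L)
          = ∑ s ∈ Uᶜ, ((a * b) s * MM (insert s U) L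
            + (c • b) s * (MM (insert s U) (a :: L) + (LL.map (MM (insert s U))).sum)) := by
        simp only [MM, Finset.mul_sum]
        rw [Finset.sum_comm]
        refine Finset.sum_congr rfl fun s hs => ?_
        have := hU (insert s U)
        simp only [MM] at this
        rw [← this, Finset.compl_insert, ← Finset.add_sum_erase _ _ hs, Finset.mul_sum]
        congr 1
        · simp [mul_assoc]
        · refine Finset.sum_congr rfl fun r _ => ?_
          rw [← mul_assoc, hc r s, ← mul_assoc]
          simp
      have e2 : ∑ s ∈ Uᶜ, (c • b) s * MM (insert s U) (a :: L) = MM U (a :: b :: L) := by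
        simp only [MM, Finset.mul_sum]
        rw [Finset.sum_comm' (t' := Uᶜ) (s' := fun r => (insert r U)ᶜ)]
        · refine Finset.sum_congr rfl fun r _ => Finset.sum_congr rfl fun s _ => ?_
          rw [← mul_assoc, ← mul_assoc, hc r s, Finset.insert_comm]
          simp
        · intro x y
          simp only [Finset.mem_compl, Finset.mem_insert]
          grind
      rw [e1]
      simp only [mul_add, Finset.sum_add_distrib]
      rw [e2, sum_MM]
      simp only [MM, Function.comp_def]
      abel

def BB (P : ℕ → (Fin n → A) → Prop) (d : ℕ) : Subalgebra ℂ A :=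
  Algebra.adjoin ℂ {x | ∃ e a, e ≤ d ∧ P e a ∧ x = ∑ r, a r}

lemma BB_mono (P : ℕ → (Fin n → A) → Prop) {d e : ℕ} (h : d ≤ e) : BB P d ≤ BB P e := by
  apply Algebra.adjoin_mono
  rintro x ⟨k, a, hk, ha, rfl⟩
  exact ⟨k, a, hk.trans h, ha, rfl⟩

lemma mem_BB {P : ℕ → (Fin n → A) → Prop} {d e : ℕ} {a : Fin n → A} (h : d ≤ e) (ha : P d a) :
    ∑ r, a r ∈ BB P e := Algebra.subset_adjoin ⟨d, a, h, ha, rfl⟩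

lemma MM_mem {P : ℕ → (Fin n → A) → Prop} (hP : Good P) : ∀ (k : ℕ) (L : List (Fin n → A))
    (D : ℕ), L.length = k → PL P D L → MM ∅ L ∈ BB P D := by
  intro k
  induction k with
  | zero =>
    intro L D hL _
    rw [List.length_eq_zero_iff] at hL
    subst hL
    exact one_mem _
  | succ k ih =>
    intro L D hL h
    rcases L with _ | ⟨a, L⟩
    · simp at hL
    · obtain ⟨d, e, rfl, ha, h⟩ := h
      obtain ⟨LL, _, h2, h3⟩ := expand hP d a ha L e h
      have hlen : L.length = k := by simpa using hL
      have := h3 ∅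
      rw [eq_sub_iff_add_eq.2 this.symm]
      refine sub_mem ?_ ?_
      · rw [← Finset.sum_mul]
        refine mul_mem ?_ (BB_mono P (by omega) (ih L e hlen h))
        simpa using mem_BB (P := P) (e := d + e) (by omega) ha
      · refine list_sum_mem fun x hx => ?_
        obtain ⟨L', hL', rfl⟩ := List.mem_map.1 hx
        obtain ⟨h4, _, h6⟩ := h2 _ hL'
        exact ih _ _ (h4.trans hlen) h6

lemma MM_lead {P : ℕ → (Fin n → A) → Prop} (hP : Good P) (hpos : ∀ d a, P d a → 1 ≤ d) :
    ∀ (k : ℕ) (L : List (Fin n → A)) (D : ℕ), L.length = k + 1 → PL P D L →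
    MM ∅ L - ((-1 : ℂ) ^ k * k.factorial) • ∑ r, L.prod r ∈ BB P (D - 1) := by
  intro k
  induction k with
  | zero =>
    intro L D hL _
    obtain ⟨a, rfl⟩ := List.length_eq_one_iff.1 hL
    simp [MM]
  | succ k ih =>
    intro L D hL h
    rcases L with _ | ⟨a, L⟩
    · simp at hL
    · obtain ⟨d, e, rfl, ha, h⟩ := h
      obtain ⟨LL, h1, h2, h3⟩ := expand hP d a ha L e h
      have hlen : L.length = k + 1 := by simpa using hL
      have hd := hpos _ _ ha
      have he : 1 ≤ e := by
        rcases L with _ | ⟨b, L⟩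
        · simp at hlen
        · obtain ⟨d', e', hh, hb, _⟩ := h
          have := hpos _ _ hb
          omega
      replace h3 := h3 ∅
      have key : (LL.map (MM ∅)).sum
          - (((k + 1 : ℕ) : ℂ) * ((-1 : ℂ) ^ k * k.factorial)) • ∑ r, (a :: L).prod r
            ∈ BB P (d + e - 1) := by
        rw [← hlen, ← h1, List.prod_cons]
        clear h3 h1
        induction LL with
        | nil => simp
        | cons L' LL ih' =>
          have t1 := ih' (fun L' h => h2 L' (List.mem_cons_of_mem _ h))
          obtain ⟨g1, g2, g3⟩ := h2 L' List.mem_cons_self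
          have t2 := ih L' (d + e) (g1.trans hlen) g3
          rw [g2] at t2
          convert add_mem t2 t1 using 1
          simp only [List.map_cons, List.sum_cons, List.length_cons, Nat.cast_add, Nat.cast_one,
            add_mul, one_mul, add_smul]
          abel
      have hp : ∑ r ∈ (∅ : Finset (Fin n))ᶜ, a r * MM ∅ L ∈ BB P (d + e - 1) := by
        rw [← Finset.sum_mul]
        refine mul_mem ?_ (BB_mono P (by omega) (MM_mem hP _ L e rfl h))
        simpa using mem_BB (P := P) (e := d + e - 1) (by omega) ha
      convert sub_mem hp key using 1
      rw [h3, pow_succ, Nat.factorial_succ]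
      push_cast
      rw [show (-1 : ℂ) ^ k * -1 * ((k + 1) * k.factorial)
        = - ((k + 1) * ((-1 : ℂ) ^ k * k.factorial)) by ring, neg_smul]
      abel

lemma MM_zero : ∀ (L : List (Fin n → A)) (U : Finset (Fin n)), n < U.card + L.length →
    MM U L = 0 := by
  intro L
  induction L with
  | nil =>
    intro U h
    have := Finset.card_le_univ U
    simp at this h
    omega
  | cons a L ih =>
    intro U h
    refine Finset.sum_eq_zero fun r hr => ?_
    rw [ih, mul_zero]
    rw [Finset.card_insert_of_notMem (by simpa using hr)]
    simp at h
    omega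

lemma psum_red {P : ℕ → (Fin n → A) → Prop} (hP : Good P) (hpos : ∀ d a, P d a → 1 ≤ d)
    (L : List (Fin n → A)) (D : ℕ) (hL : n < L.length) (h : PL P D L) :
    ∑ r, L.prod r ∈ BB P (D - 1) := by
  have := MM_lead hP hpos (L.length - 1) L D (by omega) h
  rw [MM_zero L ∅ (by simpa using hL), zero_sub] at this
  have h2 := Subalgebra.smul_mem _ (neg_mem this)
    ((-1 : ℂ) ^ (L.length - 1) * (L.length - 1).factorial)⁻¹
  rw [neg_neg, smul_smul, inv_mul_cancel₀, one_smul] at h2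
  · exact h2
  · simp [Nat.factorial_ne_zero]

open Classical in
lemma MM_ofFn (k : ℕ) : ∀ (a : Fin k → Fin n → A) (U : Finset (Fin n)),
    MM U (List.ofFn a) = ∑ f : Fin k → Fin n,
      if Function.Injective f ∧ ∀ i, f i ∉ U then (List.ofFn fun i => a i (f i)).prod else 0 := by
  induction k with
  | zero =>
    intro a U
    simp [MM, Function.injective_of_subsingleton]
  | succ k ih =>
    intro a U
    rw [← (Fin.consEquiv (fun _ : Fin (k+1) => Fin n)).sum_comp, Fintype.sum_prod_type,
      List.ofFn_succ, MM]
    rw [← Finset.sum_subset (Finset.subset_univ Uᶜ)]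
    · refine Finset.sum_congr rfl fun r hr => ?_
      rw [ih, Finset.mul_sum]
      refine Finset.sum_congr rfl fun f _ => ?_
      simp only [Fin.consEquiv, Equiv.coe_fn_mk, Fin.cons_injective_iff, Fin.forall_fin_succ,
        Fin.cons_zero, Fin.cons_succ, List.ofFn_succ, List.prod_cons, mul_ite, mul_zero]
      refine if_congr ?_ rfl rfl
      simp only [Finset.mem_insert, Set.mem_range, Finset.mem_compl] at *
      grind
    · intro r _ hr
      refine Finset.sum_eq_zero fun f _ => ?_
      rw [if_neg]
      rintro ⟨_, h⟩
      have := h 0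
      simp [Fin.consEquiv] at this hr
      exact this hr

lemma MM_perm (a : Fin n → Fin n → A) :
    MM ∅ (List.ofFn a) = ∑ σ : Equiv.Perm (Fin n), (List.ofFn fun i => a i (σ i)).prod := by
  classical
  rw [MM_ofFn, ← Finset.sum_filter]
  symm
  refine Finset.sum_bij (fun σ _ => (σ : Fin n → Fin n)) ?_ ?_ ?_ ?_
  · intro σ _; simp [σ.injective]
  · intro σ _ τ _ h; exact DFunLike.coe_injective h
  · intro f hf
    have hf : Function.Injective f := by simpa using hf
    exact ⟨Equiv.ofBijective f (Finite.injective_iff_bijective.1 hf), by simp, rfl⟩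
  · intro σ _; rfl

lemma Cm.mul_left {a a' b : Fin n → A} (h : Cm a b) (h' : Cm a' b) : Cm (a * a') b := by
  obtain ⟨c, h⟩ := h
  obtain ⟨c', h'⟩ := h'
  refine ⟨c' * c, fun r s => ?_⟩
  rw [Pi.mul_apply, mul_assoc, h', mul_smul_comm, ← mul_assoc, h, smul_mul_assoc, smul_smul,
    mul_assoc]

lemma Cm.mul_right {a b b' : Fin n → A} (h : Cm a b) (h' : Cm a b') : Cm a (b * b') := by
  obtain ⟨c, h⟩ := h
  obtain ⟨c', h'⟩ := h'
  refine ⟨c * c', fun r s => ?_⟩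
  rw [Pi.mul_apply, ← mul_assoc, h, smul_mul_assoc, mul_assoc, h', mul_smul_comm, smul_smul,
    mul_assoc]

lemma Cm.smul_left {a b : Fin n → A} (h : Cm a b) (z : ℂ) : Cm (z • a) b := by
  obtain ⟨c, h⟩ := h
  refine ⟨c, fun r s => ?_⟩
  simp [h r s, smul_comm z c]

lemma Cm.smul_right {a b : Fin n → A} (h : Cm a b) (z : ℂ) : Cm a (z • b) := by
  obtain ⟨c, h⟩ := h
  refine ⟨c, fun r s => ?_⟩
  simp [h r s, smul_comm z c]

lemma Cm.one_left (b : Fin n → A) : Cm 1 b := ⟨1, by simp⟩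
lemma Cm.one_right (b : Fin n → A) : Cm b 1 := ⟨1, by simp⟩

/-- Words in an alphabet of generators. -/
def word {α : Type*} (lt : α → Fin n → A) (w : List α) : Fin n → A := (w.map lt).prod

def WP {α : Type*} (lt : α → Fin n → A) (d : ℕ) (a : Fin n → A) : Prop :=
  ∃ (c : ℂ) (w : List α), w.length = d ∧ a = c • word lt w

lemma word_comm {α : Type*} {lt : α → Fin n → A} (h : ∀ l l', Cm (lt l) (lt l')) (w w' : List α) :
    Cm (word lt w) (word lt w') := by
  have h1 : ∀ l, Cm (lt l) (word lt w') := by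
    intro l
    induction w' with
    | nil => exact Cm.one_right _
    | cons b w ih => simpa [word] using (h l b).mul_right ih
  induction w with
  | nil => exact Cm.one_left _
  | cons b w ih => simpa [word] using (h1 b).mul_left ih

lemma WP_good {α : Type*} {lt : α → Fin n → A} (h : ∀ l l', Cm (lt l) (lt l')) :
    Good (WP lt) where
  mul := by
    rintro _ _ _ _ ⟨c, w, rfl, rfl⟩ ⟨c', w', rfl, rfl⟩
    exact ⟨c * c', w ++ w', by simp, by
      rw [smul_mul_smul_comm]; simp [word]⟩
  smul := by
    rintro _ z _ ⟨c, w, rfl, rfl⟩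
    exact ⟨z * c, w, rfl, by rw [smul_smul]⟩
  comm := by
    rintro _ _ _ _ ⟨c, w, rfl, rfl⟩ ⟨c', w', rfl, rfl⟩
    exact ((word_comm h w w').smul_left c).smul_right c'

lemma WP_good' {α : Type*} {lt : α → Fin n → A} (h : ∀ l l', Cm (lt l) (lt l')) :
    Good (fun d a => WP lt d a ∧ 1 ≤ d) where
  mul := fun d e a b ha hb => ⟨(WP_good h).mul d e a b ha.1 hb.1, by omega⟩
  smul := fun d c a ha => ⟨(WP_good h).smul d c a ha.1, ha.2⟩
  comm := fun d e a b ha hb => (WP_good h).comm d e a b ha.1 hb.1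

lemma BB_red {α : Type*} {lt : α → Fin n → A} (h : ∀ l l', Cm (lt l) (lt l')) (D : ℕ) :
    BB (WP lt) D ≤ BB (WP lt) n := by
  induction D with
  | zero => exact BB_mono _ (Nat.zero_le _)
  | succ D ih =>
    by_cases hD : D + 1 ≤ n
    · exact BB_mono _ hD
    refine Algebra.adjoin_le ?_
    rintro x ⟨e, a, he, ha, rfl⟩
    by_cases he' : e ≤ D
    · exact ih (mem_BB he' ha)
    obtain ⟨c, w, hw, rfl⟩ := ha
    have hPL : ∀ w : List α, PL (fun d a => WP lt d a ∧ 1 ≤ d) w.length (w.map lt) := by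
      intro w
      induction w with
      | nil => rfl
      | cons l w ih =>
        exact ⟨1, w.length, by simp [add_comm], ⟨⟨1, [l], rfl, by simp [word]⟩, le_rfl⟩, ih⟩
    have h1 := psum_red (WP_good' h) (fun d a h => h.2) (w.map lt) w.length
      (by simp; omega) (hPL w)
    have h2 : BB (fun d a => WP lt d a ∧ 1 ≤ d) (w.length - 1) ≤ BB (WP lt) D := by
      refine Algebra.adjoin_mono ?_
      rintro x ⟨k, a, hk, ha, rfl⟩
      exact ⟨k, a, by omega, ha.1, rfl⟩
    have h3 := ih (h2 h1)
    have := Subalgebra.smul_mem _ h3 c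
    rw [Finset.smul_sum] at this
    exact this

lemma sum_perm_mem {α : Type*} {lt : α → Fin n → A} (h : ∀ l l', Cm (lt l) (lt l'))
    (a : Fin n → Fin n → A) (ha : ∀ i, ∃ d, WP lt d (a i)) :
    ∑ σ : Equiv.Perm (Fin n), (List.ofFn fun i => a i (σ i)).prod ∈ BB (WP lt) n := by
  rw [← MM_perm]
  have : ∀ L : List (Fin n → A), (∀ b ∈ L, ∃ d, WP lt d b) → ∃ D, PL (WP lt) D L := by
    intro L
    induction L with
    | nil => exact fun _ => ⟨0, rfl⟩
    | cons b L ih =>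
      intro hL
      obtain ⟨D, hD⟩ := ih (fun b hb => hL b (List.mem_cons_of_mem _ hb))
      obtain ⟨d, hd⟩ := hL b List.mem_cons_self
      exact ⟨d + D, d, D, rfl, hd, hD⟩
  obtain ⟨D, hD⟩ := this (List.ofFn a) (by
    intro b hb
    obtain ⟨i, rfl⟩ := (List.mem_ofFn' _ _).1 hb
    exact ha i)
  exact BB_red h D (MM_mem (WP_good h) _ _ D rfl hD)

/-- Inserting a letter. -/
lemma insert_letter {α : Type*} {lt : α → Fin n → A} (h : ∀ l l', Cm (lt l) (lt l'))
    (a : Fin n → Fin n → A) (ha : ∀ i, ∃ d, WP lt d (a i)) (r : Fin n) (l : α)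
    (rs : List (Fin n)) (hr : r ∈ rs) (hnd : rs.Nodup) :
    ∃ c : ℂ, lt l r * (rs.map fun i => a i i).prod
      = c • (rs.map fun i => (Function.update a r (lt l * a r)) i i).prod := by
  induction rs with
  | nil => simp at hr
  | cons s rs ih =>
    rw [List.nodup_cons] at hnd
    by_cases hs : s = r
    · subst hs
      refine ⟨1, ?_⟩
      have : (rs.map fun i => (Function.update a s (lt l * a s)) i i) = rs.map fun i => a i i := by
        refine List.map_congr_left fun i hi => ?_
        rw [Function.update_of_ne]
        rintro rfl
        exact hnd.1 hi
      simp [this, mul_assoc]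
    · obtain ⟨c, hc⟩ := ih (by simpa [Ne.symm hs] using hr) hnd.2
      obtain ⟨d, hd⟩ := ha s
      obtain ⟨c', hc'⟩ := (WP_good h).comm 1 d (lt l) (a s) ⟨1, [l], rfl, by simp [word]⟩ hd
      refine ⟨c' * c, ?_⟩
      rw [List.map_cons, List.map_cons, List.prod_cons, List.prod_cons, ← mul_assoc, hc',
        smul_mul_assoc, mul_assoc, hc, Function.update_of_ne hs, mul_smul_comm, smul_smul]

lemma span_top {α : Type*} {lt : α → Fin n → A} (h : ∀ l l', Cm (lt l) (lt l'))
    (hgen : Algebra.adjoin ℂ {x | ∃ l r, x = lt l r} = ⊤) (x : A) :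
    x ∈ Submodule.span ℂ {y | ∃ a : Fin n → Fin n → A, (∀ i, ∃ d, WP lt d (a i)) ∧
      y = (List.ofFn fun i => a i i).prod} := by
  set W := Submodule.span ℂ {y | ∃ a : Fin n → Fin n → A, (∀ i, ∃ d, WP lt d (a i)) ∧
      y = (List.ofFn fun i => a i i).prod} with hW
  have h1 : (1 : A) ∈ W := by
    refine Submodule.subset_span ⟨fun _ => 1, fun i => ⟨0, 1, [], rfl, by simp [word]⟩, ?_⟩
    simp [List.ofFn_const]
  have hx : x ∈ Algebra.adjoin ℂ {x | ∃ l r, x = lt l r} := by rw [hgen]; trivial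
  have key : ∀ w ∈ W, x * w ∈ W := by
    induction hx using Algebra.adjoin_induction with
    | mem x hx =>
      obtain ⟨l, r, rfl⟩ := hx
      intro w hw
      induction hw using Submodule.span_induction with
      | mem y hy =>
        obtain ⟨a, ha, rfl⟩ := hy
        obtain ⟨c, hc⟩ := insert_letter h a ha r l (List.finRange n) (List.mem_finRange r)
          (List.nodup_finRange n)
        rw [List.ofFn_eq_map, hc]
        refine Submodule.smul_mem _ _ (Submodule.subset_span ⟨_, ?_, by rw [List.ofFn_eq_map]⟩)
        intro i
        by_cases hi : i = r
        · subst hi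
          obtain ⟨d, c, w, _, hw⟩ := ha i
          refine ⟨_, c, l :: w, rfl, ?_⟩
          simp [hw, word]
        · rw [Function.update_of_ne hi]
          exact ha i
      | zero => simp
      | add y z _ _ hy hz => rw [mul_add]; exact add_mem hy hz
      | smul c y _ hy => rw [mul_smul_comm]; exact Submodule.smul_mem _ _ hy
    | algebraMap c =>
      intro w hw
      rw [← Algebra.smul_def]
      exact Submodule.smul_mem _ _ hw
    | add x y _ _ hx hy => intro w hw; rw [add_mul]; exact add_mem (hx w hw) (hy w hw)
    | mul x y _ _ hx hy => intro w hw; rw [mul_assoc]; exact hx _ (hy w hw)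
  simpa using key 1 h1

lemma inv_mem {α : Type*} {lt : α → Fin n → A} (h : ∀ l l', Cm (lt l) (lt l'))
    (hgen : Algebra.adjoin ℂ {x | ∃ l r, x = lt l r} = ⊤)
    (ac : Equiv.Perm (Fin n) → A →ₐ[ℂ] A) (hac : ∀ σ l r, ac σ (lt l r) = lt l (σ r))
    (x : A) (hx : ∀ σ, ac σ x = x) : x ∈ BB (WP lt) n := by
  have key : ∑ σ, ac σ x ∈ BB (WP lt) n := by
    have hx' := span_top h hgen x
    clear hx
    induction hx' using Submodule.span_induction with
    | mem y hy =>
      obtain ⟨a, ha, rfl⟩ := hy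
      have := sum_perm_mem h a ha
      convert this using 3 with σ
      rw [map_list_prod, List.map_ofFn]
      congr 2
      funext i
      obtain ⟨d, c, w, _, hw⟩ := ha i
      have : ∀ w : List α, ac σ (word lt w i) = word lt w (σ i) := by
        intro w
        induction w with
        | nil => simp [word]
        | cons l w ih =>
          simp only [word, List.map_cons, List.prod_cons, Pi.mul_apply, map_mul, hac] at ih ⊢
          rw [ih]
      simp [hw, this]
    | zero => simp
    | add y z _ _ hy hz => simp only [map_add, Finset.sum_add_distrib]; exact add_mem hy hz
    | smul c y _ hy =>
      simp only [map_smul, ← Finset.smul_sum]; exact Subalgebra.smul_mem _ hy c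
  simp only [hx, Finset.sum_const, Finset.card_univ, Fintype.card_perm, Fintype.card_fin] at key
  rw [← Nat.cast_smul_eq_nsmul ℂ] at key
  have := Subalgebra.smul_mem _ key ((n.factorial : ℂ)⁻¹)
  rwa [smul_smul, inv_mul_cancel₀ (by simp [Nat.factorial_ne_zero]), one_smul] at this

end Gen

section Spec
variable {n m m' : ℕ}

noncomputable def ltr : Fin m ⊕ Fin m' → Fin n → R n m m'
  | Sum.inl j, r => (MvPolynomial.X (r, j)) ⊗ₜ[ℂ] 1
  | Sum.inr j, r => theta n m m' r j

lemma theta_anti (r s : Fin n) (i j : Fin m') :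
    theta n m m' r i * theta n m m' s j = - (theta n m m' s j * theta n m m' r i) := by
  rw [eq_neg_iff_add_eq_zero]
  simp only [theta, Algebra.TensorProduct.tmul_mul_tmul, mul_one, ← TensorProduct.tmul_add]
  have := ExteriorAlgebra.ι_add_mul_swap (R := ℂ)
    (Pi.single (r, i) 1 : Fin n × Fin m' → ℂ) (Pi.single (s, j) 1 : Fin n × Fin m' → ℂ)
  rw [this, TensorProduct.tmul_zero]

lemma theta_sq (r : Fin n) (i : Fin m') :
    theta n m m' r i * theta n m m' r i = 0 := by
  simp [theta, Algebra.TensorProduct.tmul_mul_tmul]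

lemma poly_comm (p : MvPolynomial (Fin n × Fin m) ℂ) (x : R n m m') :
    (p ⊗ₜ[ℂ] 1) * x = x * (p ⊗ₜ[ℂ] 1) := by
  induction x using TensorProduct.induction_on with
  | zero => simp
  | tmul a b => simp [Algebra.TensorProduct.tmul_mul_tmul, mul_comm]
  | add x y hx hy => rw [mul_add, add_mul, hx, hy]

lemma ltr_comm (l l' : Fin m ⊕ Fin m') : Cm (ltr (n := n) l) (ltr l') := by
  rcases l with i | i
  · exact ⟨1, fun r s => by rw [one_smul]; exact poly_comm _ _⟩
  rcases l' with j | j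
  · exact ⟨1, fun r s => by rw [one_smul]; exact (poly_comm _ _).symm⟩
  · exact ⟨-1, fun r s => (theta_anti _ _ _ _).trans (neg_one_smul ℂ _).symm⟩

lemma ltr_gen : Algebra.adjoin ℂ {x : R n m m' | ∃ l r, x = ltr l r} = ⊤ := by
  rw [eq_top_iff]
  rintro x -
  set W := Algebra.adjoin ℂ {x : R n m m' | ∃ l r, x = ltr l r}
  induction x using TensorProduct.induction_on with
  | zero => exact zero_mem _
  | add x y hx hy => exact add_mem hx hy
  | tmul a b =>
    have : a ⊗ₜ[ℂ] b = (a ⊗ₜ[ℂ] 1) * ((1 : MvPolynomial (Fin n × Fin m) ℂ) ⊗ₜ[ℂ] b) := by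
      simp [Algebra.TensorProduct.tmul_mul_tmul]
    rw [this]
    refine mul_mem ?_ ?_
    · change Algebra.TensorProduct.includeLeft (R := ℂ) (S := ℂ) a ∈ W
      induction a using MvPolynomial.induction_on with
      | C c =>
        rw [← MvPolynomial.algebraMap_eq, AlgHom.commutes]
        exact Subalgebra.algebraMap_mem _ c
      | add p q hp hq =>
        rw [map_add]
        exact add_mem (hp (by simp [Algebra.TensorProduct.tmul_mul_tmul]))
          (hq (by simp [Algebra.TensorProduct.tmul_mul_tmul]))
      | mul_X p i hp =>
        rw [map_mul]
        refine mul_mem (hp (by simp [Algebra.TensorProduct.tmul_mul_tmul])) ?_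
        exact Algebra.subset_adjoin ⟨Sum.inl i.2, i.1, rfl⟩
    · change Algebra.TensorProduct.includeRight (R := ℂ) b ∈ W
      clear this
      induction b using ExteriorAlgebra.induction with
      | algebraMap c =>
        rw [AlgHom.commutes]
        exact Subalgebra.algebraMap_mem _ c
      | add p q hp hq => rw [map_add]; exact add_mem hp hq
      | mul p q hp hq => rw [map_mul]; exact mul_mem hp hq
      | ι v =>
        rw [pi_eq_sum_univ' v]
        simp only [map_sum, map_smul]
        refine sum_mem fun i _ => Subalgebra.smul_mem _ ?_ _
        refine Algebra.subset_adjoin ⟨Sum.inr i.2, i.1, ?_⟩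
        simp only [ltr, theta, Algebra.TensorProduct.includeRight_apply]

lemma act_theta (σ : Equiv.Perm (Fin n)) (r : Fin n) (j : Fin m') :
    act σ (theta n m m' r j) = theta n m m' (σ r) j := by
  simp only [act, theta, Algebra.TensorProduct.map_tmul, map_one, ExteriorAlgebra.map_apply_ι]
  congr 2
  funext k
  obtain ⟨k1, k2⟩ := k
  simp only [LinearMap.funLeft_apply, Pi.single_apply, Prod.mk.injEq]
  refine if_congr ?_ rfl rfl
  rw [Equiv.Perm.inv_eq_iff_eq, eq_comm (a := k1)]

lemma act_X (σ : Equiv.Perm (Fin n)) (r : Fin n) (j : Fin m) :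
    act σ ((MvPolynomial.X (r, j)) ⊗ₜ[ℂ] 1 : R n m m') = (MvPolynomial.X (σ r, j)) ⊗ₜ[ℂ] 1 := by
  simp [act]

lemma act_ltr (σ : Equiv.Perm (Fin n)) (l : Fin m ⊕ Fin m') (r : Fin n) :
    act σ (ltr l r) = ltr l (σ r) := by
  rcases l with i | i
  · exact act_X σ r i
  · exact act_theta σ r i

lemma act_mon (σ : Equiv.Perm (Fin n)) (r : Fin n) (S : CMS m m') :
    act σ (mon n m m' r S) = mon n m m' (σ r) S := by
  rw [mon, mon, map_mul, map_list_prod, List.map_map]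
  congr 1
  · simp [act]
  · congr 1
    refine List.map_congr_left fun j _ => ?_
    simp [act_theta]

lemma act_pS (σ : Equiv.Perm (Fin n)) (S : CMS m m') : act σ (pS n S) = pS n S := by
  rw [pS, map_sum]
  simp only [act_mon]
  exact Equiv.sum_comp σ (fun r => mon n m m' r S)

lemma perm_theta {L L' : List (Fin m')} (h : L.Perm L') :
    ∃ c : ℂ, ∀ r, (L.map (fun j' => theta n m m' r j')).prod
      = c • (L'.map (fun j' => theta n m m' r j')).prod := by
  induction h with
  | nil => exact ⟨1, by simp⟩
  | cons x _ ih =>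
    obtain ⟨c, hc⟩ := ih
    exact ⟨c, fun r => by
      rw [List.map_cons, List.map_cons, List.prod_cons, List.prod_cons, hc r, mul_smul_comm]⟩
  | swap x y L =>
    refine ⟨-1, fun r => ?_⟩
    simp only [List.map_cons, List.prod_cons, ← mul_assoc]
    have h : theta n m m' r y * theta n m m' r x
        = (-1 : ℂ) • (theta n m m' r x * theta n m m' r y) :=
      (theta_anti _ _ _ _).trans (neg_one_smul ℂ _).symm
    rw [h, smul_mul_assoc]
  | trans _ _ h1 h2 =>
    obtain ⟨c, hc⟩ := h1
    obtain ⟨d, hd⟩ := h2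
    exact ⟨c * d, fun r => by rw [hc, hd, smul_smul]⟩

lemma ltr_mon (l : Fin m ⊕ Fin m') (S : CMS m m') : ∃ (c : ℂ) (T : CMS m m'),
    T.size ≤ S.size + 1 ∧ ∀ r : Fin n, ltr l r * mon n m m' r S = c • mon n m m' r T := by
  rcases l with i | i
  · refine ⟨1, (S.1 + Pi.single i 1, S.2), ?_, fun r => ?_⟩
    · simp [CMS.size, Finset.sum_add_distrib]
      omega
    · simp only [ltr, mon, one_smul, ← mul_assoc, Algebra.TensorProduct.tmul_mul_tmul, mul_one]
      congr 2
      simp only [Pi.add_apply, pow_add, Finset.prod_mul_distrib]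
      rw [mul_comm]
      congr 1
      rw [Finset.prod_eq_single i]
      · simp
      · intro j _ hj; simp [hj]
      · simp
  · by_cases hi : i ∈ S.2
    · refine ⟨0, S, by omega, fun r => ?_⟩
      have hp : (S.2.sort (· ≤ ·)).Perm (i :: (S.2.erase i).sort (· ≤ ·)) := by
        rw [← Multiset.coe_eq_coe, ← Multiset.cons_coe, Finset.sort_eq, Finset.sort_eq,
          Finset.erase_val, Multiset.cons_erase hi]
      obtain ⟨c, hc⟩ := perm_theta (n := n) (m := m) hp
      rw [zero_smul, mon, hc, ← mul_assoc, ← poly_comm, mul_assoc, ltr, List.map_cons,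
        List.prod_cons, mul_smul_comm, ← mul_assoc (theta n m m' r i), theta_sq]
      simp
    · have hp : (i :: S.2.sort (· ≤ ·)).Perm ((insert i S.2).sort (· ≤ ·)) := by
        rw [← Multiset.coe_eq_coe, ← Multiset.cons_coe, Finset.sort_eq, Finset.sort_eq,
          Finset.insert_val_of_notMem hi]
      obtain ⟨c, hc⟩ := perm_theta (n := n) (m := m) hp
      refine ⟨c, (S.1, insert i S.2), ?_, fun r => ?_⟩
      · simp [CMS.size, Finset.card_insert_of_notMem hi]
        omega
      · have := hc r
        rw [List.map_cons, List.prod_cons] at this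
        rw [mon, mon, ← mul_assoc, ← poly_comm, mul_assoc, ltr, this, mul_smul_comm]

lemma word_mon (w : List (Fin m ⊕ Fin m')) : ∃ (c : ℂ) (T : CMS m m'),
    T.size ≤ w.length ∧ ∀ r : Fin n, word ltr w r = c • mon n m m' r T := by
  induction w with
  | nil =>
    refine ⟨1, (0, ∅), by simp [CMS.size], fun r => ?_⟩
    simp [word, mon, Algebra.TensorProduct.one_def]
  | cons l w ih =>
    obtain ⟨c, T, h1, h2⟩ := ih
    obtain ⟨c', T', h3, h4⟩ := ltr_mon (n := n) l T
    refine ⟨c * c', T', by simp; omega, fun r => ?_⟩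
    have := h2 r
    simp only [word, List.map_cons, List.prod_cons, Pi.mul_apply] at this ⊢
    rw [this, mul_smul_comm, h4, smul_smul]

lemma BB_le : BB (WP (ltr (n := n) (m := m) (m' := m'))) n ≤ Algebra.adjoin ℂ
        {r : R n m m' | ∃ S : CMS m m', 1 ≤ S.size ∧ S.size ≤ n ∧ r = pS n S} := by
  refine Algebra.adjoin_le ?_
  rintro x ⟨e, a, he, ⟨c, w, hw, rfl⟩, rfl⟩
  obtain ⟨c', T, h1, h2⟩ := word_mon (n := n) w
  simp only [Pi.smul_apply, h2, ← Finset.smul_sum]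
  refine Subalgebra.smul_mem _ (Subalgebra.smul_mem _ ?_ _) _
  by_cases hT : 1 ≤ T.size
  · exact Algebra.subset_adjoin ⟨T, hT, by omega, rfl⟩
  · refine sum_mem fun r _ => ?_
    have : T.size = 0 := by omega
    simp only [CMS.size, Nat.add_eq_zero_iff, Finset.sum_eq_zero_iff, Finset.card_eq_zero,
      Finset.mem_univ, true_imp_iff] at this
    have h : mon n m m' r T = 1 := by
      simp [mon, this.1, this.2, Algebra.TensorProduct.one_def]
    rw [h]
    exact one_mem _

end Spec
end PSum

theorem invariants_eq_adjoin_powerSums (n m m' : ℕ) (hn : 0 < n) (hm : 0 < m) (hm' : 0 < m') :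
    {r : R n m m' | ∀ σ : Equiv.Perm (Fin n), act σ r = r} =
      ↑(Algebra.adjoin ℂ
        {r : R n m m' | ∃ S : CMS m m', 1 ≤ S.size ∧ S.size ≤ n ∧ r = pS n S}) := by
  apply Set.Subset.antisymm
  · intro x hx
    exact PSum.BB_le (PSum.inv_mem PSum.ltr_comm PSum.ltr_gen act PSum.act_ltr x hx)
  · intro x hx σ
    have h : Algebra.adjoin ℂ
        {r : R n m m' | ∃ S : CMS m m', 1 ≤ S.size ∧ S.size ≤ n ∧ r = pS n S}
        ≤ AlgHom.equalizer (act σ) (AlgHom.id ℂ (R n m m')) := by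
      refine Algebra.adjoin_le ?_
      rintro y ⟨S, _, _, rfl⟩
      exact PSum.act_pS σ S
    exact h hx
end

section
/- Let μ = (μ_1 ≥ … ≥ μ_ℓ) be a partition of n, let σ ∈ S_n be a permutation of cycle type μ, and let α ∈ ℕ^m. The trace of the ℂ-linear automorphism induced by σ (via x_{ij} ↦ x_{σ(i)j}) on the homogeneous component of MvPolynomial (Fin n × Fin m) ℂ consisting of polynomials of total degree α_j in the variables x_{1j},…,x_{nj} for each j ∈ {1,…,m}, is equal to the number of ℓ-tuples (M_1,…,M_ℓ) of finite multisets with entries in {1,…,m} (empty multisets allowed) such that Σ_{i=1}^{ℓ} μ_i·(multiplicity of j in M_i) = α_j for every j ∈ {1,…,m}. -/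
/-- The homogeneous component of `MvPolynomial (Fin n × Fin m) ℂ` consisting of polynomials
of total degree `α_j` in the variables `x_{1j},…,x_{nj}` for each `j`. -/
noncomputable def polyComponent (n m : ℕ) (α : Fin m → ℕ) :
    Submodule ℂ (MvPolynomial (Fin n × Fin m) ℂ) :=
  Submodule.span ℂ
    {z | ∃ d : (Fin n × Fin m) →₀ ℕ,
      (∀ j, (∑ i, d (i, j)) = α j) ∧ z = MvPolynomial.monomial d 1}

open Finset in
lemma tpp_equiv_of_multiset {A B : Type} [Fintype A] [Fintype B] (f : A → ℕ) (g : B → ℕ)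
    (h : (univ : Finset A).val.map f = (univ : Finset B).val.map g) :
    ∃ e : A ≃ B, ∀ a, g (e a) = f a := by
  classical
  have key : ∀ c, Nonempty ({a // f a = c} ≃ {b // g b = c}) := by
    intro c
    have h1 := congrArg (Multiset.count c) h
    rw [Multiset.count_map, Multiset.count_map] at h1
    refine Fintype.card_eq.1 ?_
    rw [Fintype.card_subtype, Fintype.card_subtype]
    simpa [Finset.card, Finset.filter, eq_comm] using h1
  let e := fun c => (key c).some
  exact ⟨Equiv.ofFiberEquiv e, fun a => Equiv.ofFiberEquiv_map e a⟩

open Finset Equiv.Perm in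
lemma tpp_exists_cycle_map {n : ℕ} (σ : Equiv.Perm (Fin n)) (L : List ℕ)
    (hL : (L : Multiset ℕ) = σ.partition.parts) :
    ∃ π : Fin n → Fin L.length, Function.Surjective π ∧
      (∀ x y, π x = π y ↔ σ.SameCycle x y) ∧
      ∀ k, (univ.filter (fun x => π x = k)).card = L.get k := by
  classical
  let I := {c // c ∈ σ.cycleFactorsFinset} ⊕ {x // x ∉ σ.support}
  let p : Fin n → I := fun x => if h : x ∈ σ.support then
    Sum.inl ⟨σ.cycleOf x, cycleOf_mem_cycleFactorsFinset_iff.2 h⟩ else Sum.inr ⟨x, h⟩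
  let w : I → ℕ := Sum.elim (fun c => c.1.support.card) (fun _ => 1)
  have hp : ∀ x y, p x = p y ↔ σ.SameCycle x y := by
    intro x y
    by_cases hx : x ∈ σ.support <;> by_cases hy : y ∈ σ.support
    · simp only [p, hx, hy, dite_true]
      rw [Sum.inl.injEq, Subtype.mk.injEq]
      exact (sameCycle_iff_cycleOf_eq_of_mem_support hx hy).symm
    · simp only [p, hx, hy, dite_true, dite_false, reduceCtorEq, false_iff]
      exact fun h => hy (h.mem_support_iff.1 hx)
    · simp only [p, hx, hy, dite_true, dite_false, reduceCtorEq, false_iff]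
      exact fun h => hx (h.mem_support_iff.2 hy)
    · simp only [p, hx, hy, dite_false]
      rw [Sum.inr.injEq, Subtype.mk.injEq]
      exact ⟨fun h => h.sameCycle σ, fun h => h.eq_of_left (notMem_support.1 hx)⟩
  have hcard : ∀ k, Function.Surjective p → (univ.filter (fun x => p x = k)).card = w k := by
    intro k hs
    obtain ⟨x, rfl⟩ := hs k
    simp only [hp]
    by_cases hx : x ∈ σ.support
    · simp only [w, p, hx, dite_true, Sum.elim_inl]
      congr 1
      ext y
      rw [mem_support_cycleOf_iff, mem_filter]
      simp [hx, sameCycle_comm, -mem_support]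
    · simp only [w, p, hx, dite_false, Sum.elim_inr]
      rw [card_eq_one]
      refine ⟨x, ?_⟩
      ext y
      simp only [mem_filter, mem_univ, true_and, mem_singleton]
      exact ⟨fun h => h.eq_of_right (notMem_support.1 hx), fun h => h.sameCycle σ⟩
  have hs : Function.Surjective p := by
    rintro (⟨c, hc⟩ | ⟨x, hx⟩)
    · obtain ⟨hc1, hc2⟩ := mem_cycleFactorsFinset_iff.1 hc
      obtain ⟨x, hx⟩ := hc1.nonempty_support
      refine ⟨x, ?_⟩
      have hx' : x ∈ σ.support := mem_cycleFactorsFinset_support_le hc hx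
      simp only [p, hx', dite_true]
      rw [Sum.inl.injEq, Subtype.mk.injEq]
      exact (cycle_is_cycleOf hx hc).symm
    · exact ⟨x, by simp only [p, hx, dite_false]⟩
  have hw : (univ : Finset I).val.map w = (univ : Finset (Fin L.length)).val.map L.get := by
    have h2 : (univ : Finset (Fin L.length)).val.map L.get = (L : Multiset ℕ) := by
      simp [Fin.univ_val_map]
    rw [h2, hL, parts_partition, cycleType_def]
    have h3 : (univ : Finset I).val = (univ : Finset {c // c ∈ σ.cycleFactorsFinset}).val.map Sum.inl
      + (univ : Finset {x // x ∉ σ.support}).val.map Sum.inr := rfl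
    rw [h3, Multiset.map_add, Multiset.map_map, Multiset.map_map]
    congr 1
    · have : σ.cycleFactorsFinset.val = 
        (univ : Finset {c // c ∈ σ.cycleFactorsFinset}).val.map Subtype.val := by
        exact (Multiset.attach_map_val _).symm
      conv_rhs => rw [this, Multiset.map_map]
      rfl
    · rw [show (w ∘ Sum.inr : {x // x ∉ σ.support} → ℕ) = Function.const _ 1 from rfl,
        Multiset.map_const]
      congr 1
      change Fintype.card {x // x ∉ σ.support} = _
      rw [Fintype.card_subtype_compl, Fintype.card_coe]
  obtain ⟨e, he⟩ := tpp_equiv_of_multiset _ _ hw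
  refine ⟨e ∘ p, e.surjective.comp hs, fun x y => by simp [hp], fun k => ?_⟩
  rw [← e.apply_symm_apply k, he, ← hcard _ hs]
  simp [Equiv.eq_symm_apply]

open Finset in
lemma tpp_count {n m : ℕ} (σ : Equiv.Perm (Fin n)) (L : List ℕ)
    (hL : (L : Multiset ℕ) = σ.partition.parts) (α : Fin m → ℕ) :
    Nat.card {d : (Fin n × Fin m) →₀ ℕ // (∀ j, (∑ i, d (i, j)) = α j) ∧
      d.mapDomain (fun p : Fin n × Fin m => (σ p.1, p.2)) = d} =
    Nat.card {M : Fin L.length → Multiset (Fin m) //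
      ∀ j, ∑ i, L.get i * (M i).count j = α j} := by
  classical
  obtain ⟨π, hs, hπ, hc⟩ := tpp_exists_cycle_map σ L hL
  have hmap : ∀ d : (Fin n × Fin m) →₀ ℕ,
      d.mapDomain (fun p : Fin n × Fin m => (σ p.1, p.2)) = d ↔
        ∀ i j, d (σ i, j) = d (i, j) := by
    intro d
    have hinj : Function.Injective (fun p : Fin n × Fin m => (σ p.1, p.2)) := by
      rintro ⟨a, b⟩ ⟨c, e⟩ h
      simpa using h
    constructor
    · intro h i j
      conv_lhs => rw [← h]
      exact Finsupp.mapDomain_apply hinj d (i, j)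
    · intro h
      ext ⟨i, j⟩
      have := Finsupp.mapDomain_apply hinj d (σ.symm i, j)
      simp only [Equiv.apply_symm_apply] at this
      rw [this, ← h, Equiv.apply_symm_apply]
  have hsum : ∀ g : Fin L.length → ℕ, ∑ i, g (π i) = ∑ k, L.get k * g k := by
    intro g
    rw [← Finset.sum_fiberwise univ π]
    refine Finset.sum_congr rfl fun k _ => ?_
    rw [← hc k, ← smul_eq_mul, ← Finset.sum_const]
    refine Finset.sum_congr rfl fun x hx => ?_
    rw [(mem_filter.1 hx).2]
  symm
  refine Nat.card_congr (Equiv.ofBijective (fun M =>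
    ⟨Finsupp.equivFunOnFinite.symm (fun q => (M.1 (π q.1)).count q.2), ?_, ?_⟩) ⟨?_, ?_⟩)
  · intro j
    rw [← M.2 j, ← hsum fun k => (M.1 k).count j]
    rfl
  · rw [hmap]
    intro i j
    have : π (σ i) = π i := (hπ _ _).2 (Equiv.Perm.sameCycle_apply_left.2 (Equiv.Perm.SameCycle.refl _ _))
    simp [this]
  · intro M N h
    apply Subtype.ext
    funext k
    obtain ⟨x, rfl⟩ := hs k
    ext j
    have := DFunLike.congr_fun (congrArg Subtype.val h) (x, j)
    simpa using this
  · rintro ⟨d, hd, hd2⟩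
    rw [hmap] at hd2
    have hinv : ∀ x y j, σ.SameCycle x y → d (x, j) = d (y, j) := by
      intro x y j h
      obtain ⟨i, -, rfl⟩ := h.exists_pow_eq'
      induction i with
      | zero => rfl
      | succ i ih =>
        rw [pow_succ', Equiv.Perm.mul_apply, hd2]
        exact ih ⟨i, by simp⟩
    obtain ⟨s, hs'⟩ := hs.hasRightInverse
    have hval : ∀ i j, d (s (π i), j) = d (i, j) := fun i j =>
      hinv _ _ _ ((hπ _ _).1 (hs' _))
    refine ⟨⟨fun k => Finsupp.toMultiset (Finsupp.equivFunOnFinite.symm fun j => d (s k, j)), ?_⟩, ?_⟩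
    · intro j
      rw [← hd j]
      simp only [Finsupp.count_toMultiset, Finsupp.equivFunOnFinite_symm_apply_apply]
      rw [← hsum fun k => d (s k, j)]
      exact Finset.sum_congr rfl fun i _ => hval i j
    · apply Subtype.ext
      ext ⟨i, j⟩
      simpa using hval i j

/-- If `σ ∈ S_n` has cycle type `μ = (μ_1,…,μ_ℓ)` (a partition of `n`,
including fixed points), then the trace of the automorphism `x_{ij} ↦ x_{σ(i)j}` on the
homogeneous component of multidegree `α` equals the number of `ℓ`-tuples `(M_1,…,M_ℓ)` of
finite multisets with entries in `{1,…,m}` such that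
`Σ_i μ_i·(multiplicity of j in M_i) = α_j` for every `j`. -/
theorem trace_perm_polyComponent (n m : ℕ) (hn : 0 < n) (hm : 0 < m)
    (μ : Nat.Partition n) (σ : Equiv.Perm (Fin n)) (hσ : σ.partition.parts = μ.parts)
    (α : Fin m → ℕ) :
    ∃ h : ∀ z ∈ polyComponent n m α,
        MvPolynomial.rename (fun p : Fin n × Fin m => (σ p.1, p.2)) z ∈ polyComponent n m α,
      LinearMap.trace ℂ (polyComponent n m α)
          (LinearMap.restrict
            (MvPolynomial.rename (fun p : Fin n × Fin m => (σ p.1, p.2))).toLinearMap h) =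
        (Nat.card {M : Fin (μ.parts.toList.length) → Multiset (Fin m) //
            ∀ j, ∑ i, μ.parts.toList.get i * (M i).count j = α j} : ℂ) := by
  classical
  have hinj : Function.Injective (fun p : Fin n × Fin m => (σ p.1, p.2)) := by
    rintro ⟨a, b⟩ ⟨c, e⟩ h
    simpa using h
  have hdeg : ∀ d : (Fin n × Fin m) →₀ ℕ, (∀ j, (∑ i, d (i, j)) = α j) →
      ∀ j, (∑ i, d.mapDomain (fun p : Fin n × Fin m => (σ p.1, p.2)) (i, j)) = α j := by
    intro d hd j
    rw [← hd j, ← Equiv.sum_comp σ]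
    exact Finset.sum_congr rfl fun i _ => Finsupp.mapDomain_apply hinj d (i, j)
  have h : ∀ z ∈ polyComponent n m α,
      MvPolynomial.rename (fun p : Fin n × Fin m => (σ p.1, p.2)) z ∈ polyComponent n m α := by
    intro z hz
    unfold polyComponent at hz
    induction hz using Submodule.span_induction with
    | mem z hz =>
      obtain ⟨d, hd, rfl⟩ := hz
      rw [MvPolynomial.rename_monomial]
      exact Submodule.subset_span ⟨_, hdeg d hd, rfl⟩
    | zero => rw [map_zero]; exact zero_mem _
    | add x y _ _ hx hy => rw [map_add]; exact add_mem hx hy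
    | smul a x _ hx => rw [map_smul]; exact Submodule.smul_mem _ _ hx
  refine ⟨h, ?_⟩
  rw [← tpp_count σ μ.parts.toList (by rw [Multiset.coe_toList, hσ]) α]
  let S := {d : (Fin n × Fin m) →₀ ℕ // ∀ j, (∑ i, d (i, j)) = α j}
  have hfin : Finite S := by
    let F : S → (∀ q : Fin n × Fin m, Fin (α q.2 + 1)) := fun d q =>
      ⟨d.1 q, Nat.lt_succ_of_le (by
        rw [← d.2 q.2]
        exact Finset.single_le_sum (f := fun i => d.1 (i, q.2)) (fun _ _ => Nat.zero_le _)
          (Finset.mem_univ q.1))⟩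
    refine Finite.of_injective F fun d e hde => Subtype.ext (Finsupp.ext fun q => ?_)
    exact congrArg Fin.val (congrFun hde q)
  have := Fintype.ofFinite S
  let v : S → MvPolynomial (Fin n × Fin m) ℂ := fun d => MvPolynomial.monomial d.1 1
  have hv : LinearIndependent ℂ v := by
    have := (MvPolynomial.basisMonomials (Fin n × Fin m) ℂ).linearIndependent.comp
      (fun d : S => d.1) Subtype.val_injective
    simpa [Function.comp_def, v] using this
  have hspan : Submodule.span ℂ (Set.range v) = polyComponent n m α := by
    unfold polyComponent
    congr 1
    ext z
    constructor
    · rintro ⟨d, rfl⟩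
      exact ⟨d.1, d.2, rfl⟩
    · rintro ⟨d, hd, rfl⟩
      exact ⟨⟨d, hd⟩, rfl⟩
  let b : Module.Basis S ℂ (polyComponent n m α) :=
    (Module.Basis.span hv).map (LinearEquiv.ofEq _ _ hspan)
  have hb : ∀ d : S, ((b d : polyComponent n m α) : MvPolynomial (Fin n × Fin m) ℂ) =
      MvPolynomial.monomial d.1 1 := by
    intro d
    simp [b, Module.Basis.span_apply, v]
  let τ : S → S := fun d => ⟨_, hdeg d.1 d.2⟩
  have hτ : ∀ d, LinearMap.restrict
      (MvPolynomial.rename (fun p : Fin n × Fin m => (σ p.1, p.2))).toLinearMap h (b d)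
      = b (τ d) := by
    intro d
    apply Subtype.ext
    change MvPolynomial.rename (fun p : Fin n × Fin m => (σ p.1, p.2))
      ((b d : polyComponent n m α) : MvPolynomial (Fin n × Fin m) ℂ) = _
    rw [hb, hb]
    exact MvPolynomial.rename_monomial _ _ _
  rw [LinearMap.trace_eq_matrix_trace ℂ b, Matrix.trace]
  simp only [Matrix.diag_apply, LinearMap.toMatrix_apply, hτ, Module.Basis.repr_self,
    Finsupp.single_apply]
  rw [Finset.sum_boole, ← Fintype.card_subtype, ← Nat.card_eq_fintype_card]
  congr 1
  refine Nat.card_congr ?_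
  refine (Equiv.subtypeEquivRight (q := fun d : S => d.1.mapDomain
    (fun p : Fin n × Fin m => (σ p.1, p.2)) = d.1) fun d => ?_).trans
    (Equiv.subtypeSubtypeEquivSubtypeInter
      (fun d : (Fin n × Fin m) →₀ ℕ => ∀ j, (∑ i, d (i, j)) = α j)
      (fun d => d.mapDomain (fun p : Fin n × Fin m => (σ p.1, p.2)) = d))
  exact Subtype.ext_iff
end

section
/- Let μ = (μ_1 ≥ … ≥ μ_ℓ) be a partition of n, let σ ∈ S_n be a permutation of cycle type μ, and let β ∈ ℕ^{m'}. Consider the algebra automorphism of ExteriorAlgebra ℂ (Fin n × Fin m' → ℂ) induced by the linear map permuting the standard basis vectors, e_{(i,j')} ↦ e_{(σ(i),j')}; write θ_{ij'} for the image of e_{(i,j')}. Its trace on the homogeneous component of multidegree β (the span of products of the θ's with total degree β_{j'} in θ_{1j'},…,θ_{nj'} for each j') is equal to Σ ∏_{i : |A_i| odd} (−1)^{μ_i + 1}, where the sum runs over all ℓ-tuples (A_1,…,A_ℓ) of subsets of {1,…,m'} (empty sets allowed) satisfying Σ_{i : j' ∈ A_i} μ_i = β_{j'} for every j' ∈ {1,…,m'}.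 -/
/-- The product of the generators `θ_p = ι(e_p)` over a finite set `E` of indices
(in some fixed order). -/
noncomputable def thetaMon (n m' : ℕ) (E : Finset (Fin n × Fin m')) :
    ExteriorAlgebra ℂ ((Fin n × Fin m') → ℂ) :=
  (E.toList.map (fun p => ExteriorAlgebra.ι ℂ (Pi.single p 1))).prod

/-- The homogeneous component of multidegree `β` of the exterior algebra: the span of the
products of the `θ`'s with total degree `β_{j'}` in `θ_{1j'},…,θ_{nj'}` for each `j'`. -/
noncomputable def extComponent (n m' : ℕ) (β : Fin m' → ℕ) :
    Submodule ℂ (ExteriorAlgebra ℂ ((Fin n × Fin m') → ℂ)) :=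
  Submodule.span ℂ
    {z | ∃ E : Finset (Fin n × Fin m'),
      (∀ j', (E.filter (fun p => p.2 = j')).card = β j') ∧ z = thetaMon n m' E}

/-- The algebra automorphism of the exterior algebra induced by the linear map permuting the
standard basis vectors, `e_{(i,j')} ↦ e_{(σ(i),j')}`. -/
noncomputable def extPermMap (n m' : ℕ) (σ : Equiv.Perm (Fin n)) :
    ExteriorAlgebra ℂ ((Fin n × Fin m') → ℂ) →ₐ[ℂ] ExteriorAlgebra ℂ ((Fin n × Fin m') → ℂ) :=
  ExteriorAlgebra.map (LinearMap.funLeft ℂ ℂ (fun p => (σ⁻¹ p.1, p.2)))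

open Equiv Equiv.Perm in
/-- block structure -/
theorem exists_blocks {n : ℕ} (σ : Equiv.Perm (Fin n)) :
    ∃ (I : Type) (_ : Fintype I) (_ : DecidableEq I) (c : Fin n → I) (g : I → Equiv.Perm (Fin n)),
      (∀ i, ∃ x, c x = i) ∧ (∀ x, c (σ x) = c x) ∧ (∀ x y, c x = c y → σ.SameCycle x y) ∧
      (∀ i x, g i x = if c x = i then σ x else x) ∧
      (∀ i, Equiv.Perm.sign (g i) = (-1) ^ ((Finset.univ.filter (fun x => c x = i)).card + 1)) ∧
      Finset.univ.val.map (fun i => (Finset.univ.filter (fun x => c x = i)).card)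
        = σ.partition.parts := by
  classical
  let c : Fin n → ({p // p ∈ σ.cycleFactorsFinset} ⊕ {x // x ∉ σ.support}) := fun x => if h : x ∈ σ.support then
    Sum.inl ⟨σ.cycleOf x, cycleOf_mem_cycleFactorsFinset_iff.2 h⟩ else Sum.inr ⟨x, h⟩
  let g : ({p // p ∈ σ.cycleFactorsFinset} ⊕ {x // x ∉ σ.support}) → Perm (Fin n) := Sum.elim (fun p => p.1) (fun _ => 1)
  have hl : ∀ (p) (x), c x = Sum.inl p ↔ x ∈ p.1.support := by
    intro p x
    by_cases h : x ∈ σ.support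
    · simp only [c, h, dif_pos, Sum.inl.injEq, Subtype.ext_iff]
      constructor
      · rintro h'; rw [← h']; rw [mem_support_cycleOf_iff]; exact ⟨SameCycle.refl _ _, h⟩
      · intro h'
        exact (cycle_is_cycleOf h' p.2).symm
    · simp only [c, h, dif_neg, not_false_eq_true, reduceCtorEq, false_iff]
      exact fun h' => h (mem_cycleFactorsFinset_support_le p.2 h')
  have hr : ∀ (p) (x), c x = Sum.inr p ↔ x = p.1 := by
    intro p x
    by_cases h : x ∈ σ.support
    · simp only [c, h, dif_pos, reduceCtorEq, false_iff]
      rintro rfl; exact p.2 h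
    · simp only [c, h, dif_neg, not_false_eq_true, Sum.inr.injEq, Subtype.ext_iff]
  have cl : ∀ p, (Finset.univ.filter (fun x => c x = Sum.inl p)).card = p.1.support.card := by
    intro p; congr 1; ext x; simp [hl]
  have cr : ∀ p, (Finset.univ.filter (fun x => c x = Sum.inr p)).card = 1 := by
    intro p; rw [Finset.card_eq_one]; exact ⟨p.1, by ext x; simp [hr]⟩
  refine ⟨({p // p ∈ σ.cycleFactorsFinset} ⊕ {x // x ∉ σ.support}), inferInstance, inferInstance, c, g, ?_, ?_, ?_, ?_, ?_, ?_⟩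
  · rintro (p | p)
    · obtain ⟨x, hx⟩ := (mem_cycleFactorsFinset_iff.1 p.2).1.nonempty_support
      exact ⟨x, (hl p x).2 hx⟩
    · exact ⟨p.1, (hr _ _).2 rfl⟩
  · intro x
    by_cases h : x ∈ σ.support
    · have h2 : σ x ∈ σ.support := apply_mem_support.2 h
      simp only [c, h, h2, dif_pos, Sum.inl.injEq, Subtype.ext_iff]
      exact SameCycle.cycleOf_eq (by simp [SameCycle.refl])
    · rw [notMem_support.1 h]
  · intro x y hxy
    rcases h : c y with p | p
    · rw [h] at hxy
      rw [hl] at h hxy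
      have := isCycleOn_support_of_mem_cycleFactorsFinset p.2
      exact this.2 hxy h
    · rw [h] at hxy
      rw [hr] at h hxy
      rw [h, hxy]
  · rintro (p | p) x
    · simp only [g, Sum.elim_inl, hl]
      split_ifs with h
      · exact (mem_cycleFactorsFinset_iff.1 p.2).2 x h
      · exact notMem_support.1 h
    · simp only [g, Sum.elim_inr, hr]
      split_ifs with h
      · have := p.2; rw [← h] at this; simpa using (notMem_support.1 this).symm
      · rfl
  · rintro (p | p)
    · rw [cl, pow_succ]; simp only [g, Sum.elim_inl]
      rw [(mem_cycleFactorsFinset_iff.1 p.2).1.sign]; simp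
    · rw [cr]; simp [g]
  · rw [parts_partition, cycleType_def]
    rw [← Finset.univ_disjSum_univ, Finset.val_disjSum, Multiset.disjSum, Multiset.map_add,
      Multiset.map_map, Multiset.map_map]
    congr 1
    · simp only [Function.comp_def, cl]
      have h : (Finset.univ.val.map (Subtype.val : {p // p ∈ σ.cycleFactorsFinset} → _))
            = σ.cycleFactorsFinset.val := by
        rw [Finset.univ_eq_attach]; exact congrArg Finset.val (Finset.attach_map_val (s := σ.cycleFactorsFinset))
      conv_rhs => rw [← h, Multiset.map_map]
      rfl
    · simp only [Function.comp_def, cr, Multiset.map_const']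
      congr 1
      rw [Finset.card_val, Finset.card_univ, Fintype.card_subtype_compl, Fintype.card_coe]

theorem exists_list_equiv {I : Type} [Fintype I] (f : I → ℕ) (l : List ℕ)
    (h : Finset.univ.val.map f = (l : Multiset ℕ)) :
    ∃ e : Fin l.length ≃ I, ∀ i, f (e i) = l.get i := by
  classical
  have key : ∀ c, Nonempty ({a // l.get a = c} ≃ {b // f b = c}) := by
    intro c
    rw [← Fintype.card_eq]
    have h1 : (l : Multiset ℕ) = Finset.univ.val.map l.get := by
      rw [Fin.univ_val_map, List.ofFn_get]
    rw [h1] at h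
    have := congrArg (Multiset.count c) h
    rw [Multiset.count_map, Multiset.count_map] at this
    rw [Fintype.card_subtype, Fintype.card_subtype]
    simp only [Finset.card_def, Finset.filter_val, eq_comm (b := c)]
    exact this.symm
  have k := fun c => (key c).some
  exact ⟨Equiv.ofFiberEquiv k, fun i => Equiv.ofFiberEquiv_map k i⟩

theorem exists_partial {X K : Type} [Fintype X] [DecidableEq X] [DecidableEq K]
    (τ : Equiv.Perm X) (c : X → K) (hc : ∀ x, c (τ x) = c x) (g : K → Equiv.Perm X)
    (hg : ∀ i x, g i x = if c x = i then τ x else x) (J : Finset K) :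
    ∃ π : Equiv.Perm X, (∀ x, π x = if c x ∈ J then τ x else x) ∧
      Equiv.Perm.sign π = ∏ k ∈ J, Equiv.Perm.sign (g k) := by
  induction J using Finset.induction_on with
  | empty => exact ⟨1, by simp, by simp⟩
  | insert k J hk ih =>
    obtain ⟨π, h1, h2⟩ := ih
    refine ⟨g k * π, fun x => ?_, by rw [Finset.prod_insert hk, map_mul, h2]⟩
    rw [Equiv.Perm.mul_apply, h1, hg]
    by_cases hx : c x ∈ J
    · have : c x ≠ k := fun h => hk (h ▸ hx)
      simp [hx, hc, this]
    · by_cases h : c x = k <;> simp [hx, h]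
      simp [← h, hx]

/-- dual functional to a list of basis vectors -/
noncomputable def phiList {X : Type} [Fintype X] [DecidableEq X] (l : List X) :
    ExteriorAlgebra ℂ (X → ℂ) →ₗ[ℂ] ℂ :=
  ExteriorAlgebra.liftAlternating (fun i =>
    if i = l.length then
      (Matrix.detRowAlternating (n := Fin i) (R := ℂ)).compLinearMap
        (LinearMap.pi (fun b : Fin i =>
          if h : b.1 < l.length then LinearMap.proj (l.get ⟨b.1, h⟩) else 0))
    else 0)

theorem prod_eq_ιMulti {X : Type} [Fintype X] [DecidableEq X] (l : List X) (f : X → (X → ℂ)) :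
    (l.map (fun p => ExteriorAlgebra.ι ℂ (f p))).prod =
      ExteriorAlgebra.ιMulti ℂ l.length (fun a => f (l.get a)) := by
  rw [ExteriorAlgebra.ιMulti_apply]
  congr 1
  conv_lhs => rw [← List.ofFn_get l, List.map_ofFn]
  rfl

theorem phiList_apply_self {X : Type} [Fintype X] [DecidableEq X] (l : List X)
    (v : Fin l.length → X → ℂ) :
    phiList l (ExteriorAlgebra.ιMulti ℂ l.length v) =
      Matrix.det (Matrix.of fun a b => v a (l.get b)) := by
  rw [phiList, ExteriorAlgebra.liftAlternating_apply_ιMulti, if_pos rfl,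
    AlternatingMap.compLinearMap_apply]
  change Matrix.det _ = _
  congr 1
  ext a b
  simp [LinearMap.pi_apply]

theorem phiList_eq_zero {X : Type} [Fintype X] [DecidableEq X] (l : List X) (k : ℕ)
    (v : Fin k → X → ℂ) (q : X) (hq : q ∈ l) (hv : ∀ a, v a q = 0) :
    phiList l (ExteriorAlgebra.ιMulti ℂ k v) = 0 := by
  by_cases hk : k = l.length
  · subst hk
    rw [phiList_apply_self]
    obtain ⟨b, rfl⟩ := List.get_of_mem hq
    exact Matrix.det_eq_zero_of_column_eq_zero b (fun a => hv a)
  · rw [phiList, ExteriorAlgebra.liftAlternating_apply_ιMulti, if_neg hk]; rfl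

theorem phi_thetaMon (n m' : ℕ) (E F : Finset (Fin n × Fin m')) :
    phiList E.toList (thetaMon n m' F) = if E = F then 1 else 0 := by
  rw [thetaMon]
  rw [prod_eq_ιMulti _ (fun p => Pi.single p 1)]
  split_ifs with h
  · subst h
    rw [phiList_apply_self]
    refine Eq.trans ?_ (Matrix.det_one (n := Fin E.toList.length))
    congr 1
    ext a b
    simp [Matrix.one_apply, Pi.single_apply, (E.nodup_toList).getElem_inj_iff, Fin.ext_iff, eq_comm]
  · by_cases hs : E ⊆ F
    · have hc : F.card ≠ E.card := fun h' => h (Finset.eq_of_subset_of_card_le hs h'.le)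
      rw [phiList, ExteriorAlgebra.liftAlternating_apply_ιMulti, if_neg (by simpa using hc)]; rfl
    · obtain ⟨q, hq, hq'⟩ := Finset.not_subset.1 hs
      refine phiList_eq_zero _ _ _ q (by simpa using hq) fun a => ?_
      rw [Pi.single_apply, if_neg]
      rintro rfl
      exact hq' (Finset.mem_toList.1 (List.get_mem F.toList a))

theorem perm_prod {X : Type} [DecidableEq X] {l l' : List X} (h : l.Perm l') :
    (l.map (fun p => ExteriorAlgebra.ι ℂ (Pi.single p 1 : X → ℂ))).prod =
      (l'.map (fun p => ExteriorAlgebra.ι ℂ (Pi.single p 1 : X → ℂ))).prod ∨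
    (l.map (fun p => ExteriorAlgebra.ι ℂ (Pi.single p 1 : X → ℂ))).prod =
      - (l'.map (fun p => ExteriorAlgebra.ι ℂ (Pi.single p 1 : X → ℂ))).prod := by
  induction h with
  | nil => simp
  | cons x _ ih => rcases ih with h | h <;> simp [h]
  | swap x y l =>
    right
    have := ExteriorAlgebra.ι_add_mul_swap (R := ℂ) (Pi.single x 1 : X → ℂ) (Pi.single y 1)
    simp only [List.map_cons, List.prod_cons, ← mul_assoc]
    rw [← neg_mul]
    congr 1
    rw [eq_neg_iff_add_eq_zero, add_comm, this]
  | trans _ _ h1 h2 =>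
    rcases h1 with h1 | h1 <;> rcases h2 with h2 | h2 <;> simp [h1, h2]

/-- the permutation on pairs -/
def tau {n : ℕ} (m' : ℕ) (σ : Equiv.Perm (Fin n)) : Equiv.Perm (Fin n × Fin m') :=
  Equiv.prodCongr σ (Equiv.refl _)

theorem extPermMap_thetaMon (n m' : ℕ) (σ : Equiv.Perm (Fin n)) (E : Finset (Fin n × Fin m')) :
    extPermMap n m' σ (thetaMon n m' E) =
      (E.toList.map (fun p => ExteriorAlgebra.ι ℂ (Pi.single (tau m' σ p) 1))).prod := by
  rw [thetaMon, extPermMap, map_list_prod, List.map_map]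
  congr 1
  refine List.map_congr_left fun p _ => ?_
  rw [Function.comp_apply, ExteriorAlgebra.map_apply_ι]
  congr 1
  ext ⟨i, j⟩
  obtain ⟨a, b⟩ := p
  simp only [LinearMap.funLeft_apply, Pi.single_apply, tau, Equiv.prodCongr_apply, Prod.map, Prod.mk.injEq,
    Equiv.Perm.inv_eq_iff_eq, Equiv.refl_apply]

theorem extPermMap_mem (n m' : ℕ) (σ : Equiv.Perm (Fin n)) (β : Fin m' → ℕ) :
    ∀ z ∈ extComponent n m' β, extPermMap n m' σ z ∈ extComponent n m' β := by
  intro z hz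
  suffices extComponent n m' β ≤ (extComponent n m' β).comap (extPermMap n m' σ).toLinearMap from
    this hz
  refine Submodule.span_le.2 ?_
  rintro _ ⟨E, hE, rfl⟩
  change extPermMap n m' σ _ ∈ extComponent n m' β
  rw [extPermMap_thetaMon]
  have hp : (E.toList.map (tau m' σ)).Perm (E.map (tau m' σ).toEmbedding).toList := by
    rw [List.perm_ext_iff_of_nodup ((E.nodup_toList).map (tau m' σ).injective)
      (Finset.nodup_toList _)]
    intro a
    simp only [List.mem_map, Finset.mem_toList, Finset.mem_map, Equiv.coe_toEmbedding]
  have hmem : thetaMon n m' (E.map (tau m' σ).toEmbedding) ∈ extComponent n m' β := by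
    refine Submodule.subset_span ⟨_, fun j => ?_, rfl⟩
    rw [← hE j, Finset.filter_map, Finset.card_map]
    rfl
  have := perm_prod hp
  rw [List.map_map] at this
  rcases this with h | h
  · exact h ▸ hmem
  · exact h ▸ neg_mem hmem

theorem trace_eq (n m' : ℕ) (σ : Equiv.Perm (Fin n)) (β : Fin m' → ℕ) :
    LinearMap.trace ℂ (extComponent n m' β)
      (LinearMap.restrict (extPermMap n m' σ).toLinearMap (extPermMap_mem n m' σ β)) =
    ∑ E ∈ Finset.univ.filter (fun E : Finset (Fin n × Fin m') =>
      ∀ j', (E.filter (fun p => p.2 = j')).card = β j'),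
      phiList E.toList (extPermMap n m' σ (thetaMon n m' E)) := by
  classical
  let v : {E : Finset (Fin n × Fin m') // ∀ j', (E.filter (fun p => p.2 = j')).card = β j'} → extComponent n m' β := fun E => ⟨thetaMon n m' E.1,
    Submodule.subset_span ⟨E.1, E.2, rfl⟩⟩
  let φ : {E : Finset (Fin n × Fin m') // ∀ j', (E.filter (fun p => p.2 = j')).card = β j'} → extComponent n m' β →ₗ[ℂ] ℂ := fun E =>
    (phiList E.1.toList).comp (extComponent n m' β).subtype
  have hφ : ∀ E F, φ E (v F) = if E = F then 1 else 0 := by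
    intro E F
    change phiList E.1.toList (thetaMon n m' F.1) = _
    rw [phi_thetaMon]; simp [Subtype.ext_iff]
  have hli : LinearIndependent ℂ v := by
    rw [Fintype.linearIndependent_iff]
    intro g hg E
    have := congrArg (φ E) hg
    simpa [hφ] using this
  have hsp : ⊤ ≤ Submodule.span ℂ (Set.range v) := by
    rintro ⟨z, hz⟩ -
    have : (extComponent n m' β) ≤ (Submodule.span ℂ (Set.range v)).map
        (extComponent n m' β).subtype := by
      refine Submodule.span_le.2 ?_
      rintro _ ⟨E, hE, rfl⟩
      exact ⟨v ⟨E, hE⟩, Submodule.subset_span ⟨_, rfl⟩, rfl⟩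
    obtain ⟨y, hy, h⟩ := this hz
    have : y = ⟨z, hz⟩ := Subtype.ext h
    exact this ▸ hy
  let b := Module.Basis.mk hli hsp
  have hb : ∀ E, b E = v E := fun E => Module.Basis.mk_apply hli hsp E
  have hrepr : ∀ E x, b.repr x E = φ E x := by
    intro E x
    have : (Finsupp.lapply E).comp b.repr.toLinearMap = φ E := by
      refine b.ext fun F => ?_
      rw [hb, hφ, ← hb]
      simp [Finsupp.single_apply, eq_comm]
    rw [← this]; rfl
  rw [LinearMap.trace_eq_matrix_trace ℂ b, Matrix.trace]
  rw [Finset.sum_subtype (p := fun E : Finset (Fin n × Fin m') =>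
      ∀ j', (E.filter (fun p => p.2 = j')).card = β j') _ (by simp)]
  refine Finset.sum_congr rfl fun E _ => ?_
  rw [Matrix.diag_apply, LinearMap.toMatrix_apply, hrepr, hb]
  rfl

theorem det_aux {N Y : Type} {_ : Fintype N} {_ : DecidableEq N} {_ : Fintype Y} {_ : DecidableEq Y}
    (e : N ≃ Y) (ρ : Equiv.Perm Y) (M : Matrix N N ℂ)
    (h : ∀ a b, M a b = if e b = ρ (e a) then 1 else 0) :
    M.det = ((Equiv.Perm.sign ρ : ℤ) : ℂ) := by
  rw [← Matrix.det_permutation, ← Matrix.det_submatrix_equiv_self e]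
  congr 1
  ext a b
  simp [h, Equiv.Perm.permMatrix, eq_comm]

theorem exists_list_enum {X : Type} [DecidableEq X] (E : Finset X) :
    ∃ e : Fin E.toList.length ≃ {p // p ∈ E}, ∀ a, (e a : X) = E.toList.get a :=
  ⟨((E.nodup_toList).getEquiv E.toList).trans
    (Equiv.subtypeEquivRight (fun _ => Finset.mem_toList)), fun _ => rfl⟩

theorem phi_of_invariant (n m' : ℕ) (σ : Equiv.Perm (Fin n)) (E : Finset (Fin n × Fin m'))
    (π : Equiv.Perm (Fin n × Fin m')) (hE : ∀ p, tau m' σ p ∈ E ↔ p ∈ E)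
    (hπ : ∀ p, π p = if p ∈ E then tau m' σ p else p) :
    phiList E.toList (extPermMap n m' σ (thetaMon n m' E)) = ((Equiv.Perm.sign π : ℤ) : ℂ) := by
  rw [extPermMap_thetaMon, prod_eq_ιMulti _ (fun p => Pi.single (tau m' σ p) 1),
    phiList_apply_self]
  have h1 : ∀ p, π p ∈ E ↔ p ∈ E := by
    intro p; rw [hπ]; split_ifs with h <;> simp [h, hE]
  have h2 : ∀ p, π p ≠ p → p ∈ E := by
    intro p hp; by_contra h; exact hp (by rw [hπ, if_neg h])
  rw [← Equiv.Perm.sign_subtypePerm π h1 h2]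
  obtain ⟨e, he⟩ := exists_list_enum E
  refine det_aux e _ _ fun a b => ?_
  have : π (E.toList.get a) = tau m' σ (E.toList.get a) := by
    rw [hπ, if_pos (Finset.mem_toList.1 (List.get_mem E.toList a))]
  have hiff : e b = π.subtypePerm h1 (e a) ↔ E.toList.get b = tau m' σ (E.toList.get a) := by
    rw [Subtype.ext_iff, Equiv.Perm.subtypePerm_apply, he, Subtype.coe_mk, he, this]
  rw [Matrix.of_apply, Pi.single_apply]
  exact if_congr hiff.symm rfl rfl

theorem phi_of_not_invariant (n m' : ℕ) (σ : Equiv.Perm (Fin n)) (E : Finset (Fin n × Fin m'))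
    (hE : ¬ ∀ p, tau m' σ p ∈ E → p ∈ E) :
    phiList E.toList (extPermMap n m' σ (thetaMon n m' E)) = 0 := by
  push Not at hE
  obtain ⟨p, hp, hp'⟩ := hE
  rw [extPermMap_thetaMon, prod_eq_ιMulti _ (fun p => Pi.single (tau m' σ p) 1)]
  refine phiList_eq_zero _ _ _ _ (by simpa using hp) fun a => ?_
  rw [Pi.single_apply, if_neg]
  intro h
  have := (tau m' σ).injective h
  rw [this] at hp'
  exact hp' (Finset.mem_toList.1 (List.get_mem E.toList a))

theorem main_sum (n m' : ℕ) (σ : Equiv.Perm (Fin n)) (β : Fin m' → ℕ) (I : Type) [Fintype I]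
    [DecidableEq I] (c : Fin n → I) (g : I → Equiv.Perm (Fin n))
    (hs : ∀ i, ∃ x, c x = i) (hc : ∀ x, c (σ x) = c x) (hcc : ∀ x y, c x = c y → σ.SameCycle x y)
    (hg : ∀ i x, g i x = if c x = i then σ x else x) (d : I → ℕ)
    (hd : ∀ i, (Finset.univ.filter (fun x => c x = i)).card = d i)
    (hsg : ∀ i, Equiv.Perm.sign (g i) = (-1) ^ (d i + 1)) :
    ∑ A ∈ Finset.univ.filter (fun A : I → Finset (Fin m') =>
        ∀ j', ∑ i ∈ Finset.univ.filter (fun i => j' ∈ A i), d i = β j'),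
      ∏ i ∈ Finset.univ.filter (fun i => Odd (A i).card), (-1 : ℂ) ^ (d i + 1) =
    ∑ E ∈ Finset.univ.filter (fun E : Finset (Fin n × Fin m') =>
      ∀ j', (E.filter (fun p => p.2 = j')).card = β j'),
      phiList E.toList (extPermMap n m' σ (thetaMon n m' E)) := by
  classical
  let e : (I → Finset (Fin m')) → Finset (Fin n × Fin m') := fun A =>
    Finset.univ.filter (fun p => p.2 ∈ A (c p.1))
  have hme : ∀ A p, p ∈ e A ↔ p.2 ∈ A (c p.1) := by intro A p; simp [e]
  have hcard : ∀ A j, ((e A).filter (fun p => p.2 = j)).card =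
      ∑ i ∈ Finset.univ.filter (fun i => j ∈ A i), d i := by
    intro A j
    have h1 : (e A).filter (fun p => p.2 = j) =
        (Finset.univ.filter (fun x => j ∈ A (c x))).map
          ⟨fun x => (x, j), fun x y h => (Prod.mk.inj h).1⟩ := by
      ext ⟨x, k⟩
      simp only [Finset.mem_filter, hme, Finset.mem_map, Finset.mem_univ, true_and,
        Function.Embedding.coeFn_mk, Prod.mk.injEq]
      constructor
      · rintro ⟨h, rfl⟩; exact ⟨x, h, rfl⟩
      · rintro ⟨y, h, h'⟩
        obtain ⟨rfl, rfl⟩ := Prod.mk.inj h'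
        exact ⟨h, rfl⟩
    rw [h1, Finset.card_map, Finset.card_eq_sum_card_fiberwise (f := c)
      (t := Finset.univ.filter (fun i => j ∈ A i)) (by intro x hx; simpa using hx)]
    refine Finset.sum_congr rfl fun i hi => ?_
    rw [← hd i]
    congr 1
    ext x
    simp only [Finset.mem_filter, Finset.mem_univ, true_and] at hi ⊢
    constructor
    · exact fun h => h.2
    · rintro rfl; exact ⟨hi, rfl⟩
  refine Finset.sum_of_injOn e ?_ ?_ ?_ ?_
  · intro A _ B _ h
    funext i
    obtain ⟨x, rfl⟩ := hs i
    ext j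
    rw [← hme A (x, j), ← hme B (x, j), h]
  · intro A hA
    simp only [Finset.coe_filter, Finset.mem_univ, true_and, Set.mem_ofPred_eq] at hA ⊢
    intro j; rw [hcard, hA]
  · intro E hE hEn
    by_contra hne
    have hinv : ∀ p, tau m' σ p ∈ E → p ∈ E := by
      by_contra h; exact hne (phi_of_not_invariant n m' σ E h)
    have hinv' : ∀ p, tau m' σ p ∈ E ↔ p ∈ E := by
      have hsub : E.map (tau m' σ).symm.toEmbedding ⊆ E := by
        intro p hp
        obtain ⟨q, hq, rfl⟩ := Finset.mem_map.1 hp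
        exact hinv _ (by simpa using hq)
      have heq := Finset.eq_of_subset_of_card_le hsub (by rw [Finset.card_map])
      intro p
      refine ⟨hinv p, fun hp => ?_⟩
      rw [← heq] at hp
      obtain ⟨q, hq, rfl⟩ := Finset.mem_map.1 hp
      simpa using hq
    have hcyc : ∀ x y j, σ.SameCycle x y → ((x, j) ∈ E ↔ (y, j) ∈ E) := by
      rintro x y j ⟨k, rfl⟩
      have hp : ∀ x, (σ x, j) ∈ E ↔ (x, j) ∈ E := fun x => hinv' (x, j)
      have hk : ∀ (k : ℕ) x, ((σ ^ k) x, j) ∈ E ↔ (x, j) ∈ E := by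
        intro k
        induction k with
        | zero => simp
        | succ k ih => intro x; rw [pow_succ', Equiv.Perm.mul_apply, hp, ih]
      obtain ⟨k, rfl | rfl⟩ := k.eq_nat_or_neg
      · rw [zpow_natCast, hk]
      · rw [← hk k ((σ ^ (-(k : ℤ))) x), zpow_neg, zpow_natCast,
          ← Equiv.Perm.mul_apply, mul_inv_cancel, Equiv.Perm.one_apply]
    apply hEn
    have hEe : e (fun i => Finset.univ.filter (fun j => ∃ x, c x = i ∧ (x, j) ∈ E)) = E := by
      ext ⟨x, j⟩
      simp only [hme, Finset.mem_filter, Finset.mem_univ, true_and]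
      constructor
      · rintro ⟨y, h, hy⟩
        exact (hcyc y x j (hcc _ _ h)).1 hy
      · exact fun h => ⟨x, rfl, h⟩
    refine ⟨fun i => Finset.univ.filter (fun j => ∃ x, c x = i ∧ (x, j) ∈ E), ?_, hEe⟩
    simp only [Finset.coe_filter, Finset.mem_univ, true_and, Set.mem_ofPred_eq]
    intro j
    rw [← hcard, hEe]
    exact (Finset.mem_filter.1 hE).2 j
  · intro A _
    let C : Fin n × Fin m' → I × Fin m' := fun p => (c p.1, p.2)
    let G : I × Fin m' → Equiv.Perm (Fin n × Fin m') := fun k =>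
      Equiv.prodCongrLeft (fun j => if j = k.2 then g k.1 else 1)
    have hG : ∀ k p, G k p = if C p = k then tau m' σ p else p := by
      rintro ⟨i, j⟩ ⟨x, j'⟩
      simp only [G, C, Equiv.prodCongrLeft_apply, tau, Equiv.prodCongr_apply, Prod.map,
        Prod.mk.injEq, Equiv.refl_apply]
      by_cases h : j' = j <;> by_cases h' : c x = i <;> simp [h, h', hg]
    have hGs : ∀ k, Equiv.Perm.sign (G k) = (-1) ^ (d k.1 + 1) := by
      rintro ⟨i, j⟩
      simp only [G, Equiv.Perm.sign_prodCongrLeft]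
      rw [Finset.prod_eq_single j (by intro b _ hb; simp [hb]) (by simp)]
      simp [hsg]
    let J : Finset (I × Fin m') := Finset.univ.filter (fun k => k.2 ∈ A k.1)
    obtain ⟨π, h1, h2⟩ := exists_partial (tau m' σ) C (fun x => by simp [C, tau, hc]) G hG J
    rw [phi_of_invariant n m' σ (e A) π (fun p => by rw [hme, hme]; simp [tau, hc])
      (fun p => by rw [h1]; simp [J, C, hme]), h2]
    have : ∏ k ∈ J, Equiv.Perm.sign (G k) = ∏ i, ((-1) ^ (d i + 1)) ^ (A i).card := by
      simp only [hGs, J]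
      rw [Finset.prod_filter, Fintype.prod_prod_type]
      refine Finset.prod_congr rfl fun i _ => ?_
      rw [← Finset.prod_filter]
      dsimp only
      rw [Finset.prod_const]
      congr 2
      ext j; simp
    rw [this, Finset.prod_filter]
    push_cast
    refine Finset.prod_congr rfl fun i _ => ?_
    split_ifs with h
    · rw [← pow_mul, mul_comm, pow_mul, h.neg_one_pow]
    · rw [← pow_mul, mul_comm, pow_mul, (Nat.not_odd_iff_even.1 h).neg_one_pow, one_pow]

/-- If `σ ∈ S_n` has cycle type `μ = (μ_1,…,μ_ℓ)` (including fixed points),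
the trace of the induced automorphism `θ_{ij'} ↦ θ_{σ(i)j'}` on the component of multidegree
`β` equals `Σ ∏_{i : |A_i| odd} (−1)^{μ_i+1}`, summed over all `ℓ`-tuples `(A_1,…,A_ℓ)` of
subsets of `{1,…,m'}` with `Σ_{i : j' ∈ A_i} μ_i = β_{j'}` for every `j'`. -/
theorem trace_perm_extComponent (n m' : ℕ) (hn : 0 < n) (hm' : 0 < m')
    (μ : Nat.Partition n) (σ : Equiv.Perm (Fin n)) (hσ : σ.partition.parts = μ.parts)
    (β : Fin m' → ℕ) :
    ∃ h : ∀ z ∈ extComponent n m' β, extPermMap n m' σ z ∈ extComponent n m' β,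
      LinearMap.trace ℂ (extComponent n m' β)
          (LinearMap.restrict (extPermMap n m' σ).toLinearMap h) =
        ∑ A ∈ Finset.univ.filter
            (fun A : Fin (μ.parts.toList.length) → Finset (Fin m') =>
              ∀ j', ∑ i ∈ Finset.univ.filter (fun i => j' ∈ A i), μ.parts.toList.get i = β j'),
          ∏ i ∈ Finset.univ.filter (fun i => Odd (A i).card),
            (-1 : ℂ) ^ (μ.parts.toList.get i + 1) := by
  refine ⟨extPermMap_mem n m' σ β, ?_⟩
  rw [trace_eq]
  obtain ⟨I, _, _, c, g, hs, hc, hcc, hg, hsg, hparts⟩ := exists_blocks σ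
  obtain ⟨e, he⟩ := exists_list_equiv
    (fun i => (Finset.univ.filter (fun x => c x = i)).card) μ.parts.toList
    (by rw [hparts, hσ, Multiset.coe_toList])
  refine (main_sum n m' σ β (Fin μ.parts.toList.length) (fun x => e.symm (c x)) (fun i => g (e i))
    (fun i => ?_) (fun x => by rw [hc]) (fun x y h => hcc _ _ (e.symm.injective h))
    (fun i x => ?_) (fun i => μ.parts.toList.get i) (fun i => ?_) (fun i => ?_)).symm
  · obtain ⟨x, hx⟩ := hs (e i)
    exact ⟨x, by rw [hx, Equiv.symm_apply_apply]⟩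
  · rw [hg]
    exact if_congr (Equiv.symm_apply_eq e).symm rfl rfl
  · rw [← he]
    simp only [Equiv.symm_apply_eq]
  · rw [hsg, ← he]
end

section
/- For all α ∈ ℕ^m and β ∈ ℕ^{m'}, the dimension over ℂ of the space of S_n-invariant elements of the homogeneous component R_{α,β} is equal to the number of super multiset partitions of content cont_{α,β} = {1^{α_1},…,m^{α_m},1̄^{β_1},…,m̄'^{β_{m'}}} having length at most n. -/
set_option maxHeartbeats 1000000
set_option synthInstance.maxHeartbeats 400000

open scoped TensorProduct

/-- The homogeneous component `R_{α,β}` of `R`: the span of the products of generators of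
total degree `α_j` in `x_{1j},…,x_{nj}` for each `j` and total degree `β_{j'}` in
`θ_{1j'},…,θ_{nj'}` for each `j'`. -/
noncomputable def component (n m m' : ℕ) (α : Fin m → ℕ) (β : Fin m' → ℕ) :
    Submodule ℂ (R n m m') :=
  Submodule.span ℂ
    {z : R n m m' | ∃ (d : (Fin n × Fin m) →₀ ℕ) (E : Finset (Fin n × Fin m')),
      (∀ j, (∑ i, d (i, j)) = α j) ∧
      (∀ j', (E.filter (fun p => p.2 = j')).card = β j') ∧
      z = (MvPolynomial.monomial d 1) ⊗ₜ[ℂ] thetaMon n m' E}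

/-- A multiset partition is *super* if every part with an odd number of barred entries
occurs exactly once. -/
def IsSuper {m m' : ℕ} (π : Multiset (CMS m m')) : Prop :=
  ∀ S ∈ π, Odd S.2.card → π.count S = 1

/-- `π` has content `cont_{α,β} = {1^{α_1},…,m^{α_m},1̄^{β_1},…,m̄'^{β_{m'}}}`. -/
def ContentIs {m m' : ℕ} (π : Multiset (CMS m m')) (α : Fin m → ℕ) (β : Fin m' → ℕ) : Prop :=
  (∀ j, (π.map (fun P => P.1 j)).sum = α j) ∧
    (∀ j', (π.map (fun P => if j' ∈ P.2 then 1 else 0)).sum = β j')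

/-- The submodule of `S_n`-invariant elements of `R`. -/
noncomputable def invSub (n m m' : ℕ) : Submodule ℂ (R n m m') where
  carrier := {r | ∀ σ : Equiv.Perm (Fin n), act σ r = r}
  add_mem' := by
    intro a b ha hb σ
    rw [map_add (@act n m m' σ), ha σ, hb σ]
  zero_mem' := by
    intro σ
    exact map_zero (@act n m m' σ)
  smul_mem' := by
    intro c a ha σ
    rw [map_smul (@act n m m' σ), ha σ]

theorem aux_abs {V F P G : Type*} [AddCommGroup V] [Module ℂ V] [Group G] [Fintype G]
    (B : Module.Basis F ℂ V) (I : Set F) (ρ : G → V →ₗ[ℂ] V)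
    (hmul : ∀ g h v, ρ g (ρ h v) = ρ (g * h) v) (s : G → F → F)
    (hs : ∀ g f, ρ g (B f) = B (s g f) ∨ ρ g (B f) = - B (s g f))
    (hI : ∀ g, ∀ f ∈ I, s g f ∈ I) (q : F → P)
    (hq : ∀ f f', q f = q f' ↔ ∃ g, s g f = f') (good : Set P)
    (hgood : ∀ p ∈ good, ∃ f ∈ I, q f = p)
    (h1 : ∀ f ∈ I, q f ∈ good → ∀ g, s g f = f → ρ g (B f) = B f)
    (h2 : ∀ f ∈ I, q f ∉ good → ∃ g, ρ g (B f) = - B f)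
    (N : Submodule ℂ V) (hN : ∀ v, v ∈ N ↔ ∀ g, ρ g v = v) :
    Module.finrank ℂ ↥(Submodule.span ℂ (B '' I) ⊓ N) = Nat.card good := by
  classical
  let Av : V →ₗ[ℂ] V := ∑ g, ρ g
  have hAv : ∀ v, Av v = ∑ g, ρ g v := fun v => by simp [Av]
  have hAvρ : ∀ h v, Av (ρ h v) = Av v := by
    intro h v
    rw [hAv, hAv]
    simp only [hmul]
    exact Fintype.sum_equiv (Equiv.mulRight h) _ _ (fun g => rfl)
  have hρAv : ∀ h v, ρ h (Av v) = Av v := by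
    intro h v
    rw [hAv, map_sum]
    simp only [hmul]
    exact Fintype.sum_equiv (Equiv.mulLeft h) _ _ (fun g => rfl)
  have hgood' : ∀ p : good, ∃ f ∈ I, q f = p := fun p => hgood p p.2
  choose r hrI hrq using hgood'
  let w : good → V := fun p => Av (B (r p))
  have hwI : ∀ p, w p ∈ Submodule.span ℂ (B '' I) := by
    intro p
    simp only [w, hAv]
    refine Submodule.sum_mem _ fun g _ => ?_
    have hm : B (s g (r p)) ∈ Submodule.span ℂ (B '' I) :=
      Submodule.subset_span ⟨_, hI g _ (hrI p), rfl⟩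
    rcases hs g (r p) with h | h <;> rw [h]
    · exact hm
    · exact Submodule.neg_mem _ hm
  have hwN : ∀ p, w p ∈ N := fun p => (hN _).2 fun g => hρAv g _
  have hli : LinearIndependent ℂ w := by
    let c : good → ℂ := fun p => ((Finset.univ.filter fun g => s g (r p) = r p).card : ℂ)
    refine LinearIndependent.of_pairwise_dual_eq_zero_one _
      (fun p => (c p)⁻¹ • B.coord (r p)) ?_ ?_
    · intro p p' hpp
      have : B.coord (r p) (w p') = 0 := by
        simp only [w, hAv, map_sum]
        refine Finset.sum_eq_zero fun g _ => ?_
        have hne : s g (r p') ≠ r p := by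
          intro h
          have := (hq (r p') (r p)).2 ⟨g, h⟩
          rw [hrq, hrq] at this
          exact hpp (Subtype.ext this.symm)
        rcases hs g (r p') with h | h <;> rw [h] <;> simp [hne]
      simp only [LinearMap.smul_apply, this, smul_zero]
    · intro p
      have : B.coord (r p) (w p) = c p := by
        simp only [w, hAv, map_sum, c, Finset.card_filter]
        push_cast
        refine Finset.sum_congr rfl fun g _ => ?_
        by_cases hg : s g (r p) = r p
        · rw [h1 _ (hrI p) (by rw [hrq]; exact p.2) g hg]
          simp [hg]
        · rcases hs g (r p) with h | h <;> rw [h] <;> simp [hg]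
      have hc : c p ≠ 0 := by
        obtain ⟨g, hg⟩ := (hq (r p) (r p)).1 rfl
        simp only [c]
        rw [Nat.cast_ne_zero]
        exact Finset.card_ne_zero.2 ⟨g, by simp [hg]⟩
      simp only [LinearMap.smul_apply, this, smul_eq_mul]
      exact inv_mul_cancel₀ hc
  have hsp : Submodule.span ℂ (B '' I) ⊓ N = Submodule.span ℂ (Set.range w) := by
    apply le_antisymm
    · rintro v ⟨hv, hvN⟩
      have key : ∀ v ∈ Submodule.span ℂ (B '' I), Av v ∈ Submodule.span ℂ (Set.range w) := by
        intro v hv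
        induction hv using Submodule.span_induction with
        | zero => simp
        | add x y _ _ hx hy => rw [map_add]; exact Submodule.add_mem _ hx hy
        | smul a x _ hx => rw [map_smul]; exact Submodule.smul_mem _ _ hx
        | mem x hx =>
          obtain ⟨f, hf, rfl⟩ := hx
          by_cases hg : q f ∈ good
          · obtain ⟨g, hgf⟩ := (hq (r ⟨q f, hg⟩) f).1 (hrq _)
            have hm : w ⟨q f, hg⟩ ∈ Submodule.span ℂ (Set.range w) :=
              Submodule.subset_span ⟨_, rfl⟩
            have h3 := hAvρ g (B (r ⟨q f, hg⟩))
            rcases hs g (r ⟨q f, hg⟩) with h | h <;> rw [h, hgf] at h3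
            · rw [h3]; exact hm
            · rw [map_neg, neg_eq_iff_eq_neg] at h3
              rw [h3]; exact Submodule.neg_mem _ hm
          · obtain ⟨g, h⟩ := h2 f hf hg
            have h3 := hAvρ g (B f)
            rw [h, map_neg] at h3
            have h6 : (2 : ℂ) • Av (B f) = 0 := by
              rw [two_smul]; nth_rewrite 1 [← h3]; simp
            rw [(smul_eq_zero.1 h6).resolve_left two_ne_zero]; exact Submodule.zero_mem _
      have h4 : Av v = (Fintype.card G : ℂ) • v := by
        rw [hAv, Finset.sum_congr rfl (fun g _ => (hN v).1 hvN g)]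
        simp [Nat.cast_smul_eq_nsmul]
      have h5 : v = (Fintype.card G : ℂ)⁻¹ • Av v := by
        rw [h4, inv_smul_smul₀]
        exact Nat.cast_ne_zero.2 Fintype.card_ne_zero
      rw [h5]
      exact Submodule.smul_mem _ _ (key v hv)
    · rw [Submodule.span_le]
      rintro _ ⟨p, rfl⟩
      exact ⟨hwI p, hwN p⟩
  rw [hsp]
  exact Module.finrank_eq_nat_card_basis (Module.Basis.span hli)

theorem aux_perm {A M : Type*} [Ring M] (g : A → M)
    (h : ∀ a b, g a * g b = g b * g a ∨ g a * g b = - (g b * g a)) {l l' : List A}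
    (hp : l.Perm l') : (l.map g).prod = (l'.map g).prod ∨ (l.map g).prod = -(l'.map g).prod := by
  induction hp with
  | nil => left; rfl
  | cons x _ ih =>
    rcases ih with ih | ih
    · left; simp [ih]
    · right; simp [ih]
  | swap x y l =>
    simp only [List.map_cons, List.prod_cons, ← mul_assoc]
    rcases h y x with h | h
    · left; rw [h]
    · right; rw [h, neg_mul]
  | trans _ _ h1 h2 =>
    rcases h1 with h1 | h1 <;> rcases h2 with h2 | h2 <;> rw [h1, h2] <;> simp

theorem aux_filter {A M : Type*} [Monoid M] (g : A → M) (ev : A → Prop) [DecidablePred ev]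
    (h : ∀ a b, ev a → Commute (g a) (g b)) (l : List A) :
    (l.map g).prod = ((l.filter (fun a => decide (ev a))).map g).prod *
      ((l.filter (fun a => decide (¬ ev a))).map g).prod := by
  induction l with
  | nil => simp
  | cons a l ih =>
    by_cases ha : ev a
    · simp [ha, ih, mul_assoc]
    · have hc : Commute (g a) ((l.filter (fun a => decide (ev a))).map g).prod := by
        apply Commute.list_prod_right
        intro x hx
        simp only [List.mem_map, List.mem_filter, decide_eq_true_eq] at hx
        obtain ⟨b, ⟨_, hb⟩, rfl⟩ := hx
        exact (h b a hb).symm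
      simp only [List.map_cons, List.prod_cons, ih, ha, decide_false, not_false_eq_true,
        decide_true, List.filter_cons]
      simp only [Bool.false_eq_true, if_false, if_true, List.map_cons, List.prod_cons]
      rw [← mul_assoc, hc.eq, mul_assoc]

noncomputable def auxTh {K : Type*} [DecidableEq K] (p : K) : ExteriorAlgebra ℂ (K → ℂ) :=
  ExteriorAlgebra.ι ℂ (Pi.single p 1)

theorem auxTh_anti {K : Type*} [DecidableEq K] (p q : K) :
    auxTh p * auxTh q = - (auxTh q * auxTh p) :=
  eq_neg_of_add_eq_zero_left (ExteriorAlgebra.ι_add_mul_swap _ _)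

theorem auxTh_one {K : Type*} [DecidableEq K] (p : K) (l : List K) :
    auxTh p * (l.map auxTh).prod = (-1) ^ l.length * ((l.map auxTh).prod * auxTh p) := by
  induction l with
  | nil => simp
  | cons a l ih =>
    simp only [List.map_cons, List.prod_cons, List.length_cons]
    rw [← mul_assoc, auxTh_anti p a, neg_mul, mul_assoc, ih, pow_succ]
    rcases neg_one_pow_eq_or (ExteriorAlgebra ℂ (K → ℂ)) l.length with h | h <;>
      rw [h] <;> simp [mul_assoc]

theorem auxTh_two {K : Type*} [DecidableEq K] (l' l : List K) :
    (l'.map auxTh).prod * (l.map auxTh).prod =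
      (-1) ^ (l'.length * l.length) * ((l.map auxTh).prod * (l'.map auxTh).prod) := by
  induction l' with
  | nil => simp
  | cons a l' ih =>
    simp only [List.map_cons, List.prod_cons, List.length_cons]
    rw [mul_assoc, ih, add_mul, pow_add, one_mul]
    have := auxTh_one a l
    rcases neg_one_pow_eq_or (ExteriorAlgebra ℂ (K → ℂ)) l.length with h | h <;>
    rcases neg_one_pow_eq_or (ExteriorAlgebra ℂ (K → ℂ)) (l'.length * l.length) with h' | h' <;>
      rw [h] at this <;> rw [h, h'] <;> simp only [one_mul, neg_mul, mul_neg, mul_one] at this ⊢ <;>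
      rw [← mul_assoc, this] <;> simp [mul_assoc]

theorem auxTh_basis (K : Type*) [Fintype K] [dec : DecidableEq K] :
    ∃ B : Module.Basis (Finset K) ℂ (ExteriorAlgebra ℂ (K → ℂ)),
      ∀ E, B E = (E.toList.map auxTh).prod := by
  let inst : LinearOrder K := LinearOrder.lift' (Fintype.equivFin K) (Fintype.equivFin K).injective
  let B0 := (Pi.basisFun ℂ K).ExteriorAlgebra
  have h : ∀ E : Finset K, ∃ u : ℂˣ, u • B0 E = (E.toList.map (@auxTh K dec)).prod := by
    intro E
    have h1 : ∃ l : List K, l.Nodup ∧ (∀ x, x ∈ l ↔ x ∈ E) ∧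
        B0 E = (l.map (@auxTh K dec)).prod := by
      let s : Set.powersetCard K E.card := Set.powersetCard.ofCard rfl
      refine ⟨List.ofFn (Set.powersetCard.ofFinEmbEquiv.symm s), ?_, ?_, ?_⟩
      · rw [List.nodup_ofFn]
        exact (Set.powersetCard.ofFinEmbEquiv.symm s).injective
      · intro x
        rw [List.mem_ofFn']
        exact Set.powersetCard.mem_range_ofFinEmbEquiv_symm_iff_mem s x
      · simp only [B0]
        rw [ExteriorAlgebra.basis_apply_ofCard _ (rfl : E.card = E.card), ExteriorAlgebra.ιMulti_family,
          ExteriorAlgebra.ιMulti_apply, List.map_ofFn]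
        congr 2
        funext i
        simp only [Function.comp_apply, auxTh, s]
        congr 1
        rw [Pi.basisFun_apply]
    obtain ⟨l, hl, hlE, he⟩ := h1
    have hp : E.toList.Perm l := by
      rw [List.perm_ext_iff_of_nodup E.nodup_toList hl]
      simp [hlE]
    rcases aux_perm (@auxTh K dec) (fun a b => Or.inr (auxTh_anti a b)) hp with h | h
    · exact ⟨1, by rw [h, he, one_smul]⟩
    · exact ⟨-1, by rw [h, he]; simp [Units.smul_def]⟩
  choose u hu using h
  exact ⟨B0.unitsSMul u, fun E => by rw [Module.Basis.unitsSMul_apply, hu]⟩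

noncomputable def auxA (n m' : ℕ) (σ : Equiv.Perm (Fin n)) :
    ExteriorAlgebra ℂ ((Fin n × Fin m') → ℂ) →ₐ[ℂ] ExteriorAlgebra ℂ ((Fin n × Fin m') → ℂ) :=
  ExteriorAlgebra.map (LinearMap.funLeft ℂ ℂ (fun p => (σ⁻¹ p.1, p.2)))

theorem auxA_th {n m' : ℕ} (σ : Equiv.Perm (Fin n)) (p : Fin n × Fin m') :
    auxA n m' σ (auxTh p) = auxTh (σ p.1, p.2) := by
  rw [auxA, auxTh, ExteriorAlgebra.map_apply_ι, auxTh]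
  congr 1
  funext q
  rw [LinearMap.funLeft_apply, Pi.single_apply, Pi.single_apply]
  congr 1
  rw [Prod.ext_iff, Prod.ext_iff, Equiv.Perm.inv_eq_iff_eq]

theorem auxA_list {n m' : ℕ} (σ : Equiv.Perm (Fin n)) (l : List (Fin n × Fin m')) :
    auxA n m' σ (l.map auxTh).prod = ((l.map fun p => (σ p.1, p.2)).map auxTh).prod := by
  rw [map_list_prod, List.map_map, List.map_map]
  congr 1
  apply List.map_congr_left
  intro p _
  exact auxA_th σ p

noncomputable def auxBlk {n m' : ℕ} (r : Fin n) (S : Finset (Fin m')) :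
    ExteriorAlgebra ℂ ((Fin n × Fin m') → ℂ) :=
  ((S.toList.map fun j => (r, j)).map auxTh).prod

theorem auxA_blk {n m' : ℕ} (σ : Equiv.Perm (Fin n)) (r : Fin n) (S : Finset (Fin m')) :
    auxA n m' σ (auxBlk r S) = auxBlk (σ r) S := by
  rw [auxBlk, auxA_list, auxBlk, List.map_map (l := S.toList)]
  rfl

theorem auxBlk_mul {n m' : ℕ} (r s : Fin n) (S T : Finset (Fin m')) :
    auxBlk r S * auxBlk s T = (-1) ^ (S.card * T.card) * (auxBlk s T * auxBlk r S) := by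
  rw [auxBlk, auxBlk, auxTh_two]
  simp

noncomputable def auxRows {n m' : ℕ} (T : Fin n → Finset (Fin m')) :
    ExteriorAlgebra ℂ ((Fin n × Fin m') → ℂ) :=
  ((List.finRange n).map fun r => auxBlk r (T r)).prod

theorem auxRows_fix {n m' : ℕ} (T : Fin n → Finset (Fin m')) (σ : Equiv.Perm (Fin n))
    (h : ∀ r, T (σ r) = T r) (ho : ∀ r, Odd (T r).card → σ r = r) :
    auxA n m' σ (auxRows T) = auxRows T := by
  have h0 : auxA n m' σ (auxRows T) =
      (((List.finRange n).map σ).map fun r => auxBlk r (T r)).prod := by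
    rw [auxRows, map_list_prod, List.map_map, List.map_map]
    congr 1
    apply List.map_congr_left
    intro r _
    simp only [Function.comp_apply]
    rw [auxA_blk, h]
  have hc : ∀ a b : Fin n, Even (T a).card → Commute (auxBlk a (T a)) (auxBlk b (T b)) := by
    intro a b ha
    have := auxBlk_mul a b (T a) (T b)
    rw [(ha.mul_right _).neg_one_pow, one_mul] at this
    exact this
  rw [h0, auxRows, aux_filter _ (fun r => Even (T r).card) hc,
    aux_filter _ (fun r => Even (T r).card) hc (List.finRange n)]
  congr 1
  · have hp : ((List.finRange n).map σ).Perm (List.finRange n) := by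
      rw [List.perm_ext_iff_of_nodup ((List.nodup_finRange n).map σ.injective)
        (List.nodup_finRange n)]
      intro a
      simp only [List.mem_map, List.mem_finRange, true_and, iff_true]
      exact ⟨σ.symm a, by simp⟩
    apply List.Perm.prod_eq'
    · exact (hp.filter _).map _
    · rw [List.pairwise_map]
      apply List.pairwise_of_forall_mem_list
      intro a ha b _
      simp only [List.mem_filter, decide_eq_true_eq] at ha
      exact hc a b ha.2
  · congr 1
    congr 1
    rw [List.filter_map]
    have : ((fun a => decide ¬Even (T a).card) ∘ ⇑σ) = (fun a => decide ¬Even (T a).card) := by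
      funext a
      simp only [Function.comp_apply, h]
    rw [this]
    conv_rhs => rw [← List.map_id (List.filter _ _)]
    apply List.map_congr_left
    intro a ha
    simp only [List.mem_filter, decide_eq_true_eq, Nat.not_even_iff_odd] at ha
    exact ho a ha.2

theorem auxBlk_pm {n m' : ℕ} (T : Fin n → Finset (Fin m')) (a b : Fin n) :
    auxBlk a (T a) * auxBlk b (T b) = auxBlk b (T b) * auxBlk a (T a) ∨
    auxBlk a (T a) * auxBlk b (T b) = - (auxBlk b (T b) * auxBlk a (T a)) := by
  rw [auxBlk_mul a b]
  rcases neg_one_pow_eq_or (ExteriorAlgebra ℂ ((Fin n × Fin m') → ℂ))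
    ((T a).card * (T b).card) with h | h <;> rw [h] <;> simp

theorem auxRows_swap {n m' : ℕ} (T : Fin n → Finset (Fin m')) (r s : Fin n) (hrs : r ≠ s)
    (h : T r = T s) (ho : Odd (T r).card) :
    auxA n m' (Equiv.swap r s) (auxRows T) = - auxRows T := by
  let rest := ((List.finRange n).erase r).erase s
  have hp : (List.finRange n).Perm (r :: s :: rest) := by
    refine (List.perm_cons_erase (List.mem_finRange r)).trans (List.Perm.cons _ ?_)
    apply List.perm_cons_erase
    rw [(List.nodup_finRange n).mem_erase_iff]
    exact ⟨hrs.symm, List.mem_finRange s⟩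
  have hrest : ∀ a ∈ rest, a ≠ r ∧ a ≠ s := by
    intro a ha
    have hn := (hp.nodup_iff).1 (List.nodup_finRange n)
    simp only [List.nodup_cons, List.mem_cons, not_or] at hn
    constructor
    · rintro rfl; exact hn.1.2 ha
    · rintro rfl; exact hn.2.1 ha
  have key : auxA n m' (Equiv.swap r s)
      (((r :: s :: rest).map fun r => auxBlk r (T r)).prod) =
      - (((r :: s :: rest).map fun r => auxBlk r (T r)).prod) := by
    simp only [List.map_cons, List.prod_cons, map_mul, auxA_blk, Equiv.swap_apply_left,
      Equiv.swap_apply_right]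
    have h3 : auxA n m' (Equiv.swap r s) ((rest.map fun r => auxBlk r (T r)).prod) =
        (rest.map fun r => auxBlk r (T r)).prod := by
      rw [map_list_prod, List.map_map]
      congr 1
      apply List.map_congr_left
      intro a ha
      simp only [Function.comp_apply]
      rw [auxA_blk, Equiv.swap_apply_of_ne_of_ne (hrest a ha).1 (hrest a ha).2]
    rw [h3, ← mul_assoc, ← mul_assoc, auxBlk_mul s r, ← h, (ho.mul ho).neg_one_pow]
    simp
  rcases aux_perm (fun r => auxBlk r (T r)) (auxBlk_pm T) hp with h4 | h4
  · rw [auxRows, h4, key]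
  · rw [auxRows, h4, map_neg, key]

def auxE {n m m' : ℕ} (f : Fin n → CMS m m') : Finset (Fin n × Fin m') :=
  Finset.univ.filter fun p => p.2 ∈ (f p.1).2

noncomputable def auxD {n m m' : ℕ} (f : Fin n → CMS m m') : (Fin n × Fin m) →₀ ℕ :=
  Finsupp.equivFunOnFinite.symm fun p => (f p.1).1 p.2

theorem auxE_rows {n m m' : ℕ} (f : Fin n → CMS m m') :
    thetaMon n m' (auxE f) = auxRows (fun r => (f r).2) ∨
    thetaMon n m' (auxE f) = - auxRows (fun r => (f r).2) := by
  have h : auxRows (fun r => (f r).2) =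
      (((List.finRange n).flatMap fun r => (f r).2.toList.map fun j => (r, j)).map auxTh).prod := by
    rw [auxRows]
    induction List.finRange n with
    | nil => simp
    | cons a l ih =>
      simp only [List.map_cons, List.prod_cons, List.flatMap_cons, List.map_append,
        List.prod_append, ih]
      rfl
  rw [h]
  refine aux_perm auxTh (fun a b => Or.inr (auxTh_anti a b)) ?_
  rw [List.perm_ext_iff_of_nodup (Finset.nodup_toList _)]
  · rintro ⟨i, j⟩
    simp [auxE]
  · rw [List.nodup_flatMap]
    constructor
    · intro r _
      exact (Finset.nodup_toList _).map (fun a b hab => (Prod.ext_iff.1 hab).2)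
    · refine (List.nodup_finRange n).imp ?_
      intro a b hab
      rw [Function.onFun, List.disjoint_left]
      rintro ⟨i, j⟩ h1 h2
      simp only [List.mem_map, Prod.mk.injEq] at h1 h2
      obtain ⟨_, _, h1, _⟩ := h1
      obtain ⟨_, _, h2, _⟩ := h2
      exact hab (h1.trans h2.symm)

noncomputable def auxEquiv (n m m' : ℕ) :
    (((Fin n × Fin m) →₀ ℕ) × Finset (Fin n × Fin m')) ≃ (Fin n → CMS m m') where
  toFun x i := (fun j => x.1 (i, j), Finset.univ.filter fun j => (i, j) ∈ x.2)
  invFun f := (auxD f, auxE f)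
  left_inv x := by
    refine Prod.ext ?_ ?_
    · ext ⟨i, j⟩; simp [auxD]
    · ext ⟨i, j⟩; simp [auxE]
  right_inv f := by
    funext i
    refine Prod.ext ?_ ?_
    · funext j; simp [auxD]
    · ext j; simp [auxE]

noncomputable def auxV {n m m' : ℕ} (f : Fin n → CMS m m') : R n m m' :=
  (MvPolynomial.monomial (auxD f) 1) ⊗ₜ[ℂ] thetaMon n m' (auxE f)

theorem auxV_basis (n m m' : ℕ) :
    ∃ B : Module.Basis (Fin n → CMS m m') ℂ (R n m m'), ∀ f, B f = auxV f := by
  obtain ⟨Bt, hBt⟩ := auxTh_basis (Fin n × Fin m')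
  refine ⟨((MvPolynomial.basisMonomials (Fin n × Fin m) ℂ).tensorProduct Bt).reindex
    (auxEquiv n m m'), fun f => ?_⟩
  rw [Module.Basis.reindex_apply, Module.Basis.tensorProduct_apply', hBt,
    MvPolynomial.coe_basisMonomials]
  rfl

theorem auxD_act {n m m' : ℕ} (σ : Equiv.Perm (Fin n)) (f : Fin n → CMS m m') :
    (auxD f).mapDomain (fun p => (σ p.1, p.2)) = auxD (fun i => f (σ.symm i)) := by
  have hi : Function.Injective (fun p : Fin n × Fin m => (σ p.1, p.2)) := by
    rintro ⟨a, b⟩ ⟨c, d⟩ h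
    simpa using h
  ext ⟨i, j⟩
  have : (i, j) = (fun p : Fin n × Fin m => (σ p.1, p.2)) (σ.symm i, j) := by simp
  rw [this, Finsupp.mapDomain_apply hi]
  simp [auxD]

theorem act_tmul' {n m m' : ℕ} (σ : Equiv.Perm (Fin n)) (d : (Fin n × Fin m) →₀ ℕ)
    (x : ExteriorAlgebra ℂ ((Fin n × Fin m') → ℂ)) :
    act σ ((MvPolynomial.monomial d 1) ⊗ₜ[ℂ] x) =
      (MvPolynomial.monomial (d.mapDomain (fun p => (σ p.1, p.2))) 1) ⊗ₜ[ℂ] auxA n m' σ x := by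
  rw [act, Algebra.TensorProduct.map_tmul, MvPolynomial.rename_monomial]
  rfl

theorem auxV_act {n m m' : ℕ} (σ : Equiv.Perm (Fin n)) (f : Fin n → CMS m m') :
    act σ (auxV f) = auxV (fun i => f (σ.symm i)) ∨
    act σ (auxV f) = - auxV (fun i => f (σ.symm i)) := by
  have h : auxA n m' σ (thetaMon n m' (auxE f)) = thetaMon n m' (auxE fun i => f (σ.symm i)) ∨
      auxA n m' σ (thetaMon n m' (auxE f)) = - thetaMon n m' (auxE fun i => f (σ.symm i)) := by
    have h1 := auxA_list σ (auxE f).toList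
    change auxA n m' σ (thetaMon n m' (auxE f)) = _ at h1
    rw [h1]
    refine aux_perm auxTh (fun a b => Or.inr (auxTh_anti a b)) ?_
    rw [List.perm_ext_iff_of_nodup _ (Finset.nodup_toList _)]
    · rintro ⟨i, j⟩
      simp only [List.mem_map, Finset.mem_toList, auxE, Finset.mem_filter, Finset.mem_univ,
        true_and, Prod.mk.injEq, Prod.exists]
      constructor
      · rintro ⟨a, b, h, rfl, rfl⟩; simpa using h
      · intro h; exact ⟨σ.symm i, j, h, by simp, rfl⟩
    · refine (Finset.nodup_toList _).map ?_
      rintro ⟨a, b⟩ ⟨c, d⟩ h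
      simpa using h
  rw [auxV, act_tmul', auxD_act, auxV]
  rcases h with h | h <;> rw [h]
  · left; rfl
  · right; rw [TensorProduct.tmul_neg]

theorem auxV_fix {n m m' : ℕ} (σ : Equiv.Perm (Fin n)) (f : Fin n → CMS m m')
    (h : (fun i => f (σ.symm i)) = f) (ho : ∀ r, Odd (f r).2.card → σ r = r) :
    act σ (auxV f) = auxV f := by
  have h' : ∀ r, f (σ r) = f r := fun r => by
    have := congrFun h (σ r)
    simpa using this.symm
  have h1 := auxRows_fix (fun r => (f r).2) σ (fun r => by simp only [h']) ho
  rw [auxV, act_tmul', auxD_act, h]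
  rcases auxE_rows f with h2 | h2 <;> rw [h2]
  · rw [h1]
  · rw [map_neg, h1]

theorem auxV_swap {n m m' : ℕ} (f : Fin n → CMS m m') (r s : Fin n) (hrs : r ≠ s)
    (h : f r = f s) (ho : Odd (f r).2.card) :
    act (Equiv.swap r s) (auxV f) = - auxV f := by
  have h1 := auxRows_swap (fun r => (f r).2) r s hrs (by simp only [h]) ho
  have h2 : (fun i => f ((Equiv.swap r s).symm i)) = f := by
    funext i
    rw [Equiv.symm_swap]
    by_cases hi : i = r
    · rw [hi, Equiv.swap_apply_left, h]
    · by_cases hi' : i = s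
      · rw [hi', Equiv.swap_apply_right, h]
      · rw [Equiv.swap_apply_of_ne_of_ne hi hi']
  rw [auxV, act_tmul', auxD_act, h2, ← TensorProduct.tmul_neg]
  rcases auxE_rows f with h2 | h2 <;> rw [h2]
  · rw [h1]
  · rw [map_neg, h1]

instance auxDec {m m' : ℕ} : DecidablePred (fun S : CMS m m' => 0 < S.size) :=
  fun _ => Nat.decLt _ _

def auxQ {n m m' : ℕ} (f : Fin n → CMS m m') : Multiset (CMS m m') :=
  ((Finset.univ : Finset (Fin n)).val.map f).filter (fun S => 0 < S.size)

theorem auxSize {m m' : ℕ} {S : CMS m m'} (h : ¬ 0 < S.size) : S = (fun _ => 0, ∅) := by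
  have h0 : S.size = 0 := by omega
  rw [CMS.size, Nat.add_eq_zero_iff, Finset.sum_eq_zero_iff, Finset.card_eq_zero] at h0
  refine Prod.ext ?_ h0.2
  funext j
  exact h0.1 j (Finset.mem_univ j)

theorem auxSum {m m' : ℕ} (g : CMS m m' → ℕ) (hg : g (fun _ => 0, ∅) = 0)
    (M : Multiset (CMS m m')) :
    ((M.filter (fun S => 0 < S.size)).map g).sum = (M.map g).sum := by
  induction M using Multiset.induction with
  | empty => simp
  | cons a M ih =>
    by_cases ha : 0 < a.size
    · rw [Multiset.filter_cons_of_pos (p := fun S : CMS m m' => 0 < S.size) _ ha]; simp [ih]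
    · rw [Multiset.filter_cons_of_neg (p := fun S : CMS m m' => 0 < S.size) _ ha]
      rw [ih, Multiset.map_cons, Multiset.sum_cons, auxSize ha, hg, zero_add]

theorem auxFull {m m' : ℕ} (M : Multiset (CMS m m')) :
    M = M.filter (fun S => 0 < S.size) +
      Multiset.replicate (M.card - (M.filter (fun S => 0 < S.size)).card) (fun _ => 0, ∅) := by
  have h := Multiset.filter_add_not (fun S : CMS m m' => 0 < S.size) M
  have h2 : M.filter (fun S => ¬ 0 < S.size) =
      Multiset.replicate (M.card - (M.filter (fun S => 0 < S.size)).card) (fun _ => 0, ∅) := by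
    rw [Multiset.eq_replicate]
    constructor
    · have := congrArg Multiset.card h
      rw [Multiset.card_add] at this
      omega
    · intro b hb
      exact auxSize (Multiset.mem_filter.1 hb).2
  rw [h2] at h
  exact h.symm

theorem auxPermEx {n : ℕ} {A : Type*} (f f' : Fin n → A)
    (h : (Finset.univ : Finset (Fin n)).val.map f = (Finset.univ : Finset (Fin n)).val.map f') :
    ∃ σ : Equiv.Perm (Fin n), (fun i => f (σ.symm i)) = f' := by
  classical
  have hc : ∀ c, Nonempty ({a // f a = c} ≃ {b // f' b = c}) := by
    intro c
    refine ⟨Fintype.equivOfCardEq ?_⟩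
    have := congrArg (Multiset.count c) h
    rw [Multiset.count_map, Multiset.count_map] at this
    rw [Fintype.card_subtype, Fintype.card_subtype]
    simpa [Finset.card, eq_comm] using this
  let e := Equiv.ofFiberEquiv (fun c => (hc c).some)
  refine ⟨e, ?_⟩
  funext i
  have := Equiv.ofFiberEquiv_map (fun c => (hc c).some) (e.symm i)
  rw [← this]
  exact congrArg f' (e.apply_symm_apply i)

theorem auxQ_iff {n m m' : ℕ} (f f' : Fin n → CMS m m') :
    auxQ f = auxQ f' ↔ ∃ σ : Equiv.Perm (Fin n), (fun i => f (σ.symm i)) = f' := by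
  constructor
  · intro h
    apply auxPermEx
    rw [auxFull (Finset.univ.val.map f), auxFull (Finset.univ.val.map f')]
    simp only [auxQ] at h
    rw [h]
    simp
  · rintro ⟨σ, rfl⟩
    rw [auxQ, auxQ]
    congr 1
    have h : (Finset.univ : Finset (Fin n)).val.map σ.symm = Finset.univ.val := by
      simp
    conv_lhs => rw [← h]
    rw [Multiset.map_map]
    rfl

theorem auxQ_surj {n m m' : ℕ} (π : Multiset (CMS m m')) (h : ∀ S ∈ π, 0 < S.size)
    (hn : Multiset.card π ≤ n) : ∃ f : Fin n → CMS m m', auxQ f = π := by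
  have key : ∀ M : Multiset (CMS m m'), Multiset.card M = n →
      ∃ f : Fin n → CMS m m', (Finset.univ : Finset (Fin n)).val.map f = M := by
    intro M hM
    subst hM
    induction M using Quotient.inductionOn with
    | h l =>
      refine ⟨fun i => l[i], ?_⟩
      rw [Fin.univ_val_map]
      simp
  obtain ⟨f, hf⟩ := key (π + Multiset.replicate (n - Multiset.card π) (fun _ => 0, ∅))
    (by simp; omega)
  refine ⟨f, ?_⟩
  rw [auxQ, hf, Multiset.filter_add, Multiset.filter_eq_self.2 h]
  conv_rhs => rw [← add_zero π]
  congr 1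
  rw [Multiset.filter_eq_nil]
  intro a ha
  rw [Multiset.eq_of_mem_replicate ha]
  simp [CMS.size]

theorem auxContent {n m m' : ℕ} (f : Fin n → CMS m m') (α : Fin m → ℕ) (β : Fin m' → ℕ) :
    ContentIs (auxQ f) α β ↔ (∀ j, (∑ i, auxD f (i, j)) = α j) ∧
      (∀ j', ((auxE f).filter (fun p => p.2 = j')).card = β j') := by
  have h1 : ∀ j, ((auxQ f).map (fun P => P.1 j)).sum = ∑ i, auxD f (i, j) := by
    intro j
    rw [auxQ, auxSum _ rfl, Multiset.map_map]
    rfl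
  have h2 : ∀ j', ((auxQ f).map (fun P => if j' ∈ P.2 then 1 else 0)).sum =
      ((auxE f).filter (fun p => p.2 = j')).card := by
    intro j'
    rw [auxQ, auxSum _ (by simp), Multiset.map_map]
    have : (auxE f).filter (fun p => p.2 = j') =
        (Finset.univ.filter fun i => j' ∈ (f i).2).image (fun i => (i, j')) := by
      ext ⟨i, j⟩
      simp only [auxE, Finset.mem_filter, Finset.mem_univ, true_and, Finset.mem_image,
        Prod.mk.injEq]
      constructor
      · rintro ⟨h, rfl⟩; exact ⟨i, h, rfl, rfl⟩
      · rintro ⟨a, h, rfl, rfl⟩; exact ⟨h, rfl⟩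
    rw [this, Finset.card_image_of_injective _ (fun a b hab => (Prod.ext_iff.1 hab).1),
      Finset.card_filter]
    rfl
  rw [ContentIs]
  simp only [h1, h2]

theorem auxCount {n m m' : ℕ} (f : Fin n → CMS m m') (r : Fin n) (ho : Odd (f r).2.card) :
    (auxQ f).count (f r) = (Finset.univ.filter fun i => f i = f r).card := by
  have hs : 0 < (f r).size := by
    rw [CMS.size]; have := ho.pos; omega
  rw [auxQ, Multiset.count_filter_of_pos (p := fun S : CMS m m' => 0 < S.size) hs, Multiset.count_map]
  simp only [Finset.card, Finset.filter_val, eq_comm]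

theorem act_mul' {n m m' : ℕ} (g h : Equiv.Perm (Fin n)) (v : R n m m') :
    act g (act h v) = act (g * h) v := by
  have : (act g : R n m m' →ₐ[ℂ] R n m m').comp (act h) = act (g * h) := by
    rw [act, act, act, ← Algebra.TensorProduct.map_comp]
    congr 1
    · ext p; simp
    · rw [ExteriorAlgebra.map_comp_map]
      congr 1
  exact DFunLike.congr_fun this v

/-- The dimension over `ℂ` of the space of `S_n`-invariant elements of the
homogeneous component `R_{α,β}` equals the number of super multiset partitions of content
`cont_{α,β}` of length at most `n`. -/
theorem finrank_invariants_component (n m m' : ℕ) (hn : 0 < n) (hm : 0 < m) (hm' : 0 < m')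
    (α : Fin m → ℕ) (β : Fin m' → ℕ) :
    Module.finrank ℂ ↥(component n m m' α β ⊓ invSub n m m') =
      Nat.card {π : Multiset (CMS m m') //
        (∀ S ∈ π, 0 < S.size) ∧ IsSuper π ∧ ContentIs π α β ∧ Multiset.card π ≤ n} := by
  obtain ⟨B, hB⟩ := auxV_basis n m m'
  have hcomp : component n m m' α β = Submodule.span ℂ (B '' {f | ContentIs (auxQ f) α β}) := by
    rw [component]
    congr 1
    ext z
    simp only [Set.mem_setOf_eq, Set.mem_image, auxContent, hB]
    constructor
    · rintro ⟨d, E, h1, h2, rfl⟩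
      obtain ⟨hd, hE⟩ := Prod.ext_iff.1 ((auxEquiv n m m').symm_apply_apply (d, E))
      change auxD (auxEquiv n m m' (d, E)) = d at hd
      change auxE (auxEquiv n m m' (d, E)) = E at hE
      refine ⟨auxEquiv n m m' (d, E), ⟨?_, ?_⟩, ?_⟩
      · rw [hd]; exact h1
      · rw [hE]; exact h2
      · rw [auxV, hd, hE]
    · rintro ⟨f, ⟨h1, h2⟩, rfl⟩
      exact ⟨auxD f, auxE f, h1, h2, rfl⟩
  have hgo : ∀ f : Fin n → CMS m m', ContentIs (auxQ f) α β →
      (auxQ f ∈ {π : Multiset (CMS m m') | (∀ S ∈ π, 0 < S.size) ∧ IsSuper π ∧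
        ContentIs π α β ∧ Multiset.card π ≤ n} ↔ IsSuper (auxQ f)) := by
    intro f hf
    constructor
    · exact fun h => h.2.1
    · intro h
      refine ⟨fun S hS => (Multiset.mem_filter.1 hS).2, h, hf, ?_⟩
      refine (Multiset.card_le_card (Multiset.filter_le _ _)).trans ?_
      simp
  rw [hcomp]
  refine aux_abs B _ (fun σ => (act σ).toLinearMap) (fun g h v => act_mul' g h v)
    (fun σ f i => f (σ.symm i)) ?_ ?_ auxQ auxQ_iff
    {π : Multiset (CMS m m') | (∀ S ∈ π, 0 < S.size) ∧ IsSuper π ∧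
        ContentIs π α β ∧ Multiset.card π ≤ n} ?_ ?_ ?_ _ (fun v => Iff.rfl)
  · intro g f
    simp only [hB]
    exact auxV_act g f
  · intro g f hf
    have := (auxQ_iff f _).2 ⟨g, rfl⟩
    simp only [Set.mem_setOf_eq] at hf ⊢
    rwa [← this]
  · rintro π ⟨h1, h2, h3, h4⟩
    obtain ⟨f, rfl⟩ := auxQ_surj π h1 h4
    exact ⟨f, h3, rfl⟩
  · intro f hf hg σ hσ
    simp only [hB]
    refine auxV_fix σ f hσ fun r hr => ?_
    rw [hgo f hf] at hg
    have hmem : f r ∈ auxQ f := by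
      refine Multiset.mem_filter.2 ⟨by simp, ?_⟩
      rw [CMS.size]; have := hr.pos; omega
    have hc := hg _ hmem hr
    rw [auxCount f r hr, Finset.card_eq_one] at hc
    obtain ⟨a, ha⟩ := hc
    have h1 : r ∈ ({a} : Finset (Fin n)) := by rw [← ha]; simp
    have h2 : σ r ∈ ({a} : Finset (Fin n)) := by
      rw [← ha]
      have := congrFun hσ (σ r)
      simp only [Equiv.symm_apply_apply] at this
      simp [this]
    rw [Finset.mem_singleton] at h1 h2
    rw [h1, ← h1, h2, h1]
  · intro f hf hg
    rw [hgo f hf, IsSuper] at hg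
    push Not at hg
    obtain ⟨S, hS, ho, hc⟩ := hg
    obtain ⟨r, -, rfl⟩ := Multiset.mem_map.1 (Multiset.mem_filter.1 hS).1
    have hpos := Multiset.count_pos.2 hS
    rw [auxCount f r ho] at hc hpos
    obtain ⟨a, ha, b, hb, hab⟩ := Finset.one_lt_card.1 (by omega :
      1 < (Finset.univ.filter fun i => f i = f r).card)
    simp only [Finset.mem_filter, Finset.mem_univ, true_and] at ha hb
    refine ⟨Equiv.swap a b, ?_⟩
    simp only [hB]
    exact auxV_swap f a b hab (ha.trans hb.symm) (by rw [ha]; exact ho)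
end
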